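/- arXiv:1909.07090 — 4 statements merged into one kernel-verified Lean document; each statement's English description precedes it below -/
import Mathlib

section
/- Let d ≥ 1 and n ≥ 2 be integers, let t₁ ∈ ℝ^d be a fixed point, and let r₁, …, rₙ > 0. Then the (n−1)d-dimensional Lebesgue measure of the set {(t₂, …, tₙ) ∈ (ℝ^d)^{n−1} : ⋂_{i=1}^{n} B(tᵢ, rᵢ) ≠ ∅} is equal to the sum, over all tuples of integers (k₂, …, kₙ) with 0 ≤ kᵢ ≤ d for every i and with Σ_{i=ℓ}^{n} kᵢ ≥ (n−ℓ)d for every ℓ = 2, …, n, of the terms r₁^{(n−1)d − Σ_{i=2}^{n} kᵢ} · (∏_{i=2}^{n} rᵢ^{kᵢ} ω_{kᵢ}) · [ω_d ω_{(n−1)d − Σ_{i=2}^{n} kᵢ} / (ω_{Σ_{i=2}^{n} kᵢ − (n−2)d} ∏_{i=2}^{n} ω_{d−kᵢ})] · [d! / ((Σ_{i=2}^{n} kᵢ − (n−2)d)! ∏_{i=2}^{n} (d−kᵢ)!)]. -/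
open MeasureTheory Metric

/-- `omegaBall k` is the volume of the `k`-dimensional unit ball. -/
noncomputable def omegaBall (k : ℕ) : ℝ :=
  Real.pi ^ ((k : ℝ) / 2) / Real.Gamma (1 + (k : ℝ) / 2)

/-- The zonotope spanned by the vectors `v j`, centred at the origin. -/
def centredZonotope {ι V : Type*} [Fintype ι] [AddCommGroup V] [Module ℝ V] (v : ι → V) : Set V :=
  (fun t : ι → ℝ => ∑ j, t j • v j) '' Set.Icc (fun _ => -(1 / 2)) (fun _ => 1 / 2)

section Zonotope

variable {ι V W : Type*} [Fintype ι] [AddCommGroup V] [Module ℝ V] [AddCommGroup W] [Module ℝ W]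

theorem mem_centredZonotope {v : ι → V} {x : V} :
    x ∈ centredZonotope v ↔ ∃ t : ι → ℝ, (∀ j, |t j| ≤ 1 / 2) ∧ ∑ j, t j • v j = x := by
  simp only [centredZonotope, Set.mem_image, Set.mem_Icc, Pi.le_def, abs_le, forall_and]

theorem image_centredZonotope (A : V →ₗ[ℝ] W) (v : ι → V) :
    A '' centredZonotope v = centredZonotope (fun j => A (v j)) := by
  rw [centredZonotope, centredZonotope, Set.image_image]
  simp [map_sum]

theorem convex_centredZonotope (v : ι → V) : Convex ℝ (centredZonotope v) := by
  have h := (convex_Icc (𝕜 := ℝ) (fun _ : ι => -(1 / 2 : ℝ)) (fun _ => 1 / 2)).linear_image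
    (Fintype.linearCombination ℝ v)
  exact h

theorem isCompact_centredZonotope [TopologicalSpace V] [ContinuousAdd V] [ContinuousSMul ℝ V]
    (v : ι → V) : IsCompact (centredZonotope v) :=
  isCompact_Icc.image (by fun_prop)

theorem zero_mem_centredZonotope (v : ι → V) : (0 : V) ∈ centredZonotope v :=
  mem_centredZonotope.2 ⟨0, by simp, by simp⟩

end Zonotope

/-- Thickening a compact convex set by a unit segment in the first coordinate adds the volume of
its projection. -/
theorem volume_thicken_prod {N : ℕ} {K : Set (ℝ × (Fin N → ℝ))} (hK : IsCompact K)
    (hconv : Convex ℝ K) :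
    volume {p : ℝ × (Fin N → ℝ) | ∃ t : ℝ, |t| ≤ 1 / 2 ∧ (p.1 - t, p.2) ∈ K}
      = volume K + volume (Prod.snd '' K) := by
  set T := {p : ℝ × (Fin N → ℝ) | ∃ t : ℝ, |t| ≤ 1 / 2 ∧ (p.1 - t, p.2) ∈ K} with hT
  have hTc : IsCompact T := by
    have : T = (fun q : ℝ × (ℝ × (Fin N → ℝ)) => (q.2.1 + q.1, q.2.2)) ''
        (Set.Icc (-(1 / 2)) (1 / 2) ×ˢ K) := by
      ext ⟨x, y⟩
      simp only [hT, Set.mem_ofPred_eq, Set.mem_image, Set.mem_prod, Set.mem_Icc, Prod.exists,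
        Prod.mk.injEq]
      constructor
      · rintro ⟨t, ht, h⟩
        exact ⟨t, x - t, y, ⟨abs_le.1 ht, h⟩, by ring, rfl⟩
      · rintro ⟨t, x', y', ⟨ht, h⟩, rfl, rfl⟩
        exact ⟨t, abs_le.2 ht, by simpa using h⟩
    rw [this]
    exact (isCompact_Icc.prod hK).image (by fun_prop)
  have hP : IsCompact (Prod.snd '' K) := hK.image continuous_snd
  rw [Measure.volume_eq_prod, Measure.prod_apply_symm hTc.measurableSet,
    Measure.prod_apply_symm hK.measurableSet, ← lintegral_indicator_one hP.measurableSet,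
    ← lintegral_add_right _ (measurable_one.indicator hP.measurableSet)]
  congr 1
  ext y
  by_cases hy : y ∈ Prod.snd '' K
  · rw [Set.indicator_of_mem hy]
    set S : Set ℝ := (fun x => (x, y)) ⁻¹' K with hS
    have hSne : S.Nonempty := by
      obtain ⟨⟨x, y'⟩, hxy, rfl⟩ := hy
      exact ⟨x, hxy⟩
    have hSc : IsCompact S := by
      have : S = Prod.fst '' (K ∩ {p | p.2 = y}) := by
        ext x
        constructor
        · intro hx
          exact ⟨(x, y), ⟨hx, rfl⟩, rfl⟩
        · rintro ⟨⟨x', y'⟩, ⟨h, rfl⟩, rfl⟩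
          exact h
      rw [this]
      exact (hK.inter_right (isClosed_eq continuous_snd continuous_const)).image continuous_fst
    have hSconv : Convex ℝ S := by
      intro x hx x' hx' a b ha hb hab
      have := hconv hx hx' ha hb hab
      simp only [Prod.smul_mk, Prod.mk_add_mk, ← add_smul, hab, one_smul] at this
      exact this
    have hSI := eq_Icc_of_connected_compact ⟨hSne, hSconv.isPreconnected⟩ hSc
    set a := sInf S
    set b := sSup S
    have hab : a ≤ b := by
      rw [hSI] at hSne
      exact Set.nonempty_Icc.1 hSne
    have hTI : (fun x => (x, y)) ⁻¹' T = Set.Icc (a - 1 / 2) (b + 1 / 2) := by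
      ext x
      have : x ∈ (fun x => (x, y)) ⁻¹' T ↔ ∃ t : ℝ, |t| ≤ 1 / 2 ∧ x - t ∈ S := Iff.rfl
      rw [this, hSI]
      simp only [Set.mem_Icc]
      constructor
      · rintro ⟨t, ht, h1, h2⟩
        rw [abs_le] at ht
        constructor <;> linarith
      · rintro ⟨h1, h2⟩
        refine ⟨x - max a (min b x), ?_, ?_⟩
        · rw [abs_le]
          constructor
          · have : max a (min b x) ≤ x + 1 / 2 :=
              max_le (by linarith) ((min_le_right _ _).trans (by linarith))
            linarith
          · have : x - 1 / 2 ≤ max a (min b x) :=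
              le_max_of_le_right (le_min (by linarith) (by linarith))
            linarith
        · rw [sub_sub_cancel]
          exact ⟨le_max_left _ _, max_le hab (min_le_left _ _)⟩
    rw [hTI, hSI, Real.volume_Icc, Real.volume_Icc, Pi.one_apply, ← ENNReal.ofReal_one,
      ← ENNReal.ofReal_add (by linarith) zero_le_one]
    congr 1
    ring
  · rw [Set.indicator_of_notMem hy]
    have h1 : (fun x => (x, y)) ⁻¹' K = ∅ := by
      ext x
      simp only [Set.mem_preimage, Set.mem_empty_iff_false, iff_false]
      exact fun h => hy ⟨_, h, rfl⟩
    have h2 : (fun x => (x, y)) ⁻¹' T = ∅ := by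
      ext x
      simp only [Set.mem_preimage, Set.mem_empty_iff_false, iff_false]
      rintro ⟨t, -, h⟩
      exact hy ⟨_, h, rfl⟩
    rw [h1, h2]
    simp

theorem volume_thicken {N : ℕ} {K : Set (Fin (N + 1) → ℝ)} (hK : IsCompact K)
    (hconv : Convex ℝ K) :
    volume {x : Fin (N + 1) → ℝ | ∃ t : ℝ, |t| ≤ 1 / 2 ∧ x - t • Pi.single 0 1 ∈ K}
      = volume K + volume ((fun x : Fin (N + 1) → ℝ => fun i : Fin N => x i.succ) '' K) := by
  set e := MeasurableEquiv.piFinSuccAbove (fun _ : Fin (N + 1) => ℝ) 0 with he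
  have hmp : MeasurePreserving e volume volume :=
    volume_preserving_piFinSuccAbove (fun _ : Fin (N + 1) => ℝ) 0
  let L : (Fin (N + 1) → ℝ) →ₗ[ℝ] ℝ × (Fin N → ℝ) :=
    (LinearMap.proj 0).prod (LinearMap.pi fun i => LinearMap.proj i.succ)
  have heL : ∀ x, e x = L x := fun x => rfl
  have himg : e '' K = L '' K := rfl
  have hLc : Continuous L := L.continuous_of_finiteDimensional
  have h := volume_thicken_prod (K := L '' K) (hK.image hLc) (hconv.linear_image L)
  rw [← hmp.measure_preimage_equiv, ← hmp.measure_preimage_equiv (L '' K)] at h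
  have hinj : Function.Injective L := e.injective
  have e1 : e ⁻¹' (L '' K) = K := by
    rw [← himg, Set.preimage_image_eq _ e.injective]
  have e2 : Prod.snd '' (L '' K)
      = (fun x : Fin (N + 1) → ℝ => fun i : Fin N => x i.succ) '' K := by
    rw [Set.image_image]
    rfl
  rw [e1, e2] at h
  rw [← h]
  congr 1
  ext x
  simp only [Set.mem_ofPred_eq, Set.mem_preimage]
  refine exists_congr fun t => and_congr_right fun _ => ?_
  have : ((e x).1 - t, (e x).2) = L (x - t • Pi.single 0 1) := by
    rw [map_sub, heL]
    ext i <;> simp [L]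
  rw [this]
  exact (hinj.mem_set_image).symm

theorem volume_centredZonotope_image_equiv {N : ℕ} {ι : Type*} [Fintype ι]
    (A : (Fin N → ℝ) →ₗ[ℝ] (Fin N → ℝ)) (v : ι → Fin N → ℝ) :
    volume.real (centredZonotope fun j => A (v j))
      = |LinearMap.det A| * volume.real (centredZonotope v) := by
  rw [← image_centredZonotope, Measure.real, Measure.addHaar_image_linearMap, ENNReal.toReal_mul,
    ENNReal.toReal_ofReal (abs_nonneg _), Measure.real]

theorem det_of_map {κ : Type*} [Fintype κ] [DecidableEq κ] (A : (κ → ℝ) →ₗ[ℝ] (κ → ℝ))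
    (x : κ → κ → ℝ) :
    (Matrix.of fun a => A (x a)).det = LinearMap.det A * (Matrix.of x).det := by
  have : (Matrix.of fun a => A (x a)) = Matrix.of x * (LinearMap.toMatrix' A).transpose := by
    ext a b
    rw [Matrix.mul_apply, Matrix.of_apply, ← LinearMap.toMatrix'_mulVec A (x a), Matrix.mulVec,
      dotProduct]
    simp [mul_comm]
  rw [this, Matrix.det_mul, Matrix.det_transpose, LinearMap.det_toMatrix', mul_comm]

/-- Terms of a sum over functions that vanish as soon as the function takes the value `0` can be
dropped. -/
theorem sum_fun_succ {α M : Type*} [Fintype α] [DecidableEq α] [AddCommMonoid M] {m : ℕ}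
    (G : (α → Fin (m + 1)) → M) (hG : ∀ f a, f a = 0 → G f = 0) :
    ∑ f, G f = ∑ f : α → Fin m, G fun a => (f a).succ := by
  refine (Fintype.sum_of_injective (fun (f : α → Fin m) a => (f a).succ) ?_ _ _ ?_ fun _ => rfl).symm
  · intro f g h
    ext a
    simpa using congrArg Fin.val (congrFun h a)
  · intro f hf
    by_contra hne
    refine hf ⟨fun a => (f a).pred fun h => hne (hG f a h), ?_⟩
    ext a
    simp

theorem sum_abs_det_cons_single {N m : ℕ} (v : Fin (m + 1) → Fin (N + 1) → ℝ)
    (hv : v 0 = Pi.single 0 1) :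
    ∑ f : Fin (N + 1) → Fin (m + 1), |(Matrix.of fun a => v (f a)).det|
      = ∑ f : Fin (N + 1) → Fin m, |(Matrix.of fun a => v (f a).succ).det|
        + (N + 1) * ∑ f : Fin N → Fin m,
            |(Matrix.of fun a (b : Fin N) => v (f a).succ b.succ).det| := by
  set G : (Fin (N + 1) → Fin (m + 1)) → ℝ := fun f => |(Matrix.of fun a => v (f a)).det| with hG
  have hGinj : ∀ f : Fin (N + 1) → Fin (m + 1), ∀ p q, p ≠ q → f p = f q → G f = 0 := by
    intro f p q hpq h
    rw [hG]
    simp only [abs_eq_zero]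
    refine Matrix.det_zero_of_row_eq hpq ?_
    ext b
    simp [h]
  have hsplit : ∀ f, G f = (if ∃ p, f p = 0 then 0 else G f)
      + ∑ p, if f p = 0 then G f else 0 := by
    intro f
    by_cases h : ∃ p, f p = 0
    · obtain ⟨p, hp⟩ := h
      rw [if_pos ⟨p, hp⟩, zero_add, Finset.sum_eq_single p, if_pos hp]
      · intro q _ hq
        split_ifs with h
        · exact hGinj f q p hq (h.trans hp.symm)
        · rfl
      · simp
    · rw [if_neg h]
      push Not at h
      simp [h]
  have h1 : ∑ f, G f = ∑ f, (if ∃ p, f p = 0 then 0 else G f)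
      + ∑ p, ∑ f, if f p = 0 then G f else 0 := by
    rw [Finset.sum_comm, ← Finset.sum_add_distrib]
    exact Finset.sum_congr rfl fun f _ => hsplit f
  rw [h1]
  congr 1
  · rw [sum_fun_succ]
    · refine Finset.sum_congr rfl fun f _ => ?_
      rw [if_neg]
      simp [Fin.succ_ne_zero]
    · intro f a ha
      rw [if_pos ⟨a, ha⟩]
  · have h2 : ∀ p : Fin (N + 1), (∑ f : Fin (N + 1) → Fin (m + 1), if f p = 0 then G f else 0)
        = ∑ f : Fin N → Fin m, |(Matrix.of fun a (b : Fin N) => v (f a).succ b.succ).det| := by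
      intro p
      rw [← (Fin.insertNthEquiv (fun _ => Fin (m + 1)) p).sum_comp, Fintype.sum_prod_type,
        Finset.sum_eq_single 0]
      · rw [sum_fun_succ]
        · refine Finset.sum_congr rfl fun f _ => ?_
          simp only [Fin.insertNthEquiv_apply, Fin.insertNth_apply_same, if_true, hG]
          rw [Matrix.det_succ_row _ p, Finset.sum_eq_single 0]
          · simp only [Matrix.of_apply, Fin.insertNth_apply_same, hv, Pi.single_eq_same, mul_one,
              abs_mul, abs_pow, abs_neg, abs_one, one_pow, one_mul]
            congr 2
            ext a b
            simp
          · intro b _ hb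
            simp [hv, hb]
          · simp
        · intro f a ha
          simp only [Fin.insertNthEquiv_apply, Fin.insertNth_apply_same, if_true]
          refine hGinj _ p (p.succAbove a) (Fin.succAbove_ne p a).symm ?_
          simp [ha]
      · intro q _ hq
        refine Finset.sum_eq_zero fun f _ => ?_
        simp [hq]
      · simp
    rw [Finset.sum_congr rfl fun p _ => h2 p]
    simp

theorem volume_centredZonotope_cons_single {N m : ℕ} (v : Fin (m + 1) → Fin (N + 1) → ℝ)
    (hv : v 0 = Pi.single 0 1) :
    volume.real (centredZonotope v) = volume.real (centredZonotope fun j : Fin m => v j.succ)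
      + volume.real (centredZonotope fun (j : Fin m) (b : Fin N) => v j.succ b.succ) := by
  have h := volume_thicken (isCompact_centredZonotope fun j : Fin m => v j.succ)
    (convex_centredZonotope _)
  have e1 : {x : Fin (N + 1) → ℝ | ∃ t : ℝ, |t| ≤ 1 / 2 ∧
      x - t • Pi.single 0 1 ∈ centredZonotope fun j : Fin m => v j.succ} = centredZonotope v := by
    ext x
    simp only [Set.mem_ofPred_eq, mem_centredZonotope]
    constructor
    · rintro ⟨t, ht, s, hs, hx⟩
      refine ⟨Fin.cons t s, fun j => ?_, ?_⟩
      · refine Fin.cases ?_ (fun j => ?_) j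
        · simpa using ht
        · simpa using hs j
      · rw [Fin.sum_univ_succ]
        simp [hx, hv]
    · rintro ⟨t, ht, rfl⟩
      refine ⟨t 0, ht 0, fun j => t j.succ, fun j => ht _, ?_⟩
      rw [Fin.sum_univ_succ, hv, add_sub_cancel_left]
  have e2 : (fun x : Fin (N + 1) → ℝ => fun i : Fin N => x i.succ) ''
      (centredZonotope fun j : Fin m => v j.succ)
      = centredZonotope fun (j : Fin m) (b : Fin N) => v j.succ b.succ := by
    let L : (Fin (N + 1) → ℝ) →ₗ[ℝ] (Fin N → ℝ) := LinearMap.pi fun i => LinearMap.proj i.succ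
    exact image_centredZonotope L _
  rw [e1, e2] at h
  rw [Measure.real, h, ENNReal.toReal_add]
  · rfl
  · exact (isCompact_centredZonotope _).measure_ne_top
  · exact (isCompact_centredZonotope _).measure_ne_top

theorem volume_singleton_fin_zero (x : Fin 0 → ℝ) : volume {x} = 1 := by
  rw [volume_pi, Measure.pi_of_empty _ x]
  simp

theorem volume_centredZonotope_fin (N m : ℕ) (v : Fin m → Fin N → ℝ) :
    volume.real (centredZonotope v)
      = (∑ f : Fin N → Fin m, |(Matrix.of fun a => v (f a)).det|) / N.factorial := by
  induction m generalizing N with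
  | zero =>
    have : centredZonotope v = {0} := by
      ext x
      simp [mem_centredZonotope, eq_comm]
    rw [this]
    cases N with
    | zero =>
      rw [Measure.real, volume_singleton_fin_zero]
      simp
    | succ N => simp [Measure.real]
  | succ m ih =>
    cases N with
    | zero =>
      have : centredZonotope v = {0} := by
        ext x
        rw [Subsingleton.elim x 0]
        simpa using zero_mem_centredZonotope v
      rw [this]
      rw [Measure.real, volume_singleton_fin_zero]
      simp
    | succ N =>
      by_cases hv : v 0 = 0
      · have e : centredZonotope v = centredZonotope fun j : Fin m => v j.succ := by
          ext x
          simp only [mem_centredZonotope]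
          constructor
          · rintro ⟨t, ht, rfl⟩
            exact ⟨fun j => t j.succ, fun j => ht _, by rw [Fin.sum_univ_succ]; simp [hv]⟩
          · rintro ⟨s, hs, hx⟩
            refine ⟨Fin.cons 0 s, fun j => ?_, ?_⟩
            · refine Fin.cases ?_ (fun j => ?_) j
              · simp
              · simpa using hs j
            · rw [Fin.sum_univ_succ]
              simp [hx, hv]
        rw [e, ih, sum_fun_succ]
        intro f a ha
        rw [abs_eq_zero]
        exact Matrix.det_eq_zero_of_row_eq_zero a fun b => by simp [ha, hv]
      · obtain ⟨A, hA⟩ := SeparatingDual.exists_continuousLinearEquiv_apply_eq (R := ℝ) hv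
          (y := (Pi.single 0 1 : Fin (N + 1) → ℝ)) (by simp)
        set B : (Fin (N + 1) → ℝ) →ₗ[ℝ] (Fin (N + 1) → ℝ) := A.toLinearEquiv.toLinearMap with hB
        have hdet : |LinearMap.det B| ≠ 0 := by
          rw [abs_ne_zero]
          exact (LinearEquiv.isUnit_det' A.toLinearEquiv).ne_zero
        apply mul_left_cancel₀ hdet
        rw [← volume_centredZonotope_image_equiv, ← mul_div_assoc, Finset.mul_sum]
        simp_rw [← abs_mul, ← det_of_map]
        rw [volume_centredZonotope_cons_single (fun j => B (v j)) hA, ih, ih,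
          sum_abs_det_cons_single (fun j => B (v j)) hA, Nat.factorial_succ]
        push_cast
        field_simp

/-- The volume of a zonotope is the sum of the volumes of the parallelotopes spanned by its
generators. -/
theorem volume_centredZonotope {ι κ : Type*} [Fintype ι] [Fintype κ] [DecidableEq κ]
    (v : ι → κ → ℝ) :
    volume.real (centredZonotope v)
      = (∑ f : κ → ι, |(Matrix.of fun a => v (f a)).det|) / (Fintype.card κ).factorial := by
  let eκ := Fintype.equivFin κ
  let eι := Fintype.equivFin ι
  have h := volume_centredZonotope_fin (Fintype.card κ) (Fintype.card ι)
    fun j b => v (eι.symm j) (eκ.symm b)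
  have hvol : volume.real (centredZonotope v) = volume.real (centredZonotope
      fun (j : Fin (Fintype.card ι)) (b : Fin (Fintype.card κ)) => v (eι.symm j) (eκ.symm b)) := by
    have hmp := volume_measurePreserving_piCongrLeft (fun _ : κ => ℝ) eκ.symm
    rw [Measure.real, Measure.real, ← hmp.measure_preimage_equiv]
    congr 2
    ext x
    simp only [Set.mem_preimage, mem_centredZonotope]
    have hx : ∀ a, MeasurableEquiv.piCongrLeft (fun _ : κ => ℝ) eκ.symm x a = x (eκ a) := by
      intro a
      conv_lhs => rw [← eκ.symm_apply_apply a]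
      exact Equiv.piCongrLeft_apply_apply (fun _ : κ => ℝ) eκ.symm x (eκ a)
    constructor
    · rintro ⟨t, ht, h⟩
      refine ⟨fun j => t (eι.symm j), fun j => ht _, ?_⟩
      ext b
      have h1 := congrFun h (eκ.symm b)
      rw [hx, Equiv.apply_symm_apply] at h1
      rw [← h1, ← eι.symm.sum_comp]
      simp
    · rintro ⟨t, ht, h⟩
      refine ⟨fun j => t (eι j), fun j => ht _, ?_⟩
      ext a
      rw [hx, ← h, ← eι.symm.sum_comp]
      simp
  rw [hvol, h]
  congr 1
  rw [← (Equiv.arrowCongr eκ eι).sum_comp]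
  refine Finset.sum_congr rfl fun f _ => ?_
  rw [← Matrix.det_submatrix_equiv_self eκ.symm]
  congr 2
  ext a b
  simp [Equiv.arrowCongr]

section Zonoid

variable {E : Type*} [NormedAddCommGroup E] [InnerProductSpace ℝ E]

open scoped RealInnerProductSpace Pointwise

theorem centredZonotope_subset_closedBall {ι : Type*} [Fintype ι] {v : ι → E} {R : ℝ} (hR : 0 ≤ R)
    (h : ∀ x, (∑ j, |⟪v j, x⟫|) / 2 ≤ R * ‖x‖) : centredZonotope v ⊆ closedBall 0 R := by
  intro y hy
  obtain ⟨t, ht, rfl⟩ := mem_centredZonotope.1 hy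
  set y := ∑ j, t j • v j with hy
  rw [mem_closedBall_zero_iff]
  have h1 : ‖y‖ * ‖y‖ ≤ R * ‖y‖ := by
    refine le_trans ?_ (h y)
    rw [← real_inner_self_eq_norm_mul_norm]
    nth_rewrite 1 [hy]
    rw [sum_inner, Finset.sum_div]
    refine Finset.sum_le_sum fun j _ => ?_
    rw [real_inner_smul_left]
    refine (le_abs_self _).trans ?_
    rw [abs_mul, div_eq_inv_mul]
    exact mul_le_mul_of_nonneg_right ((ht j).trans (by norm_num)) (abs_nonneg _)
  by_contra hlt
  push Not at hlt
  nlinarith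

theorem closedBall_subset_centredZonotope [FiniteDimensional ℝ E] {ι : Type*} [Fintype ι]
    {v : ι → E} {R : ℝ}
    (h : ∀ x, R * ‖x‖ ≤ (∑ j, |⟪v j, x⟫|) / 2) : closedBall 0 R ⊆ centredZonotope v := by
  intro y hy
  by_contra hyZ
  obtain ⟨f, c, hfc, hc⟩ := geometric_hahn_banach_point_closed (convex_centredZonotope v)
    (isCompact_centredZonotope v).isClosed hyZ
  set x := (InnerProductSpace.toDual ℝ E).symm f with hx
  have hf : ∀ z, f z = ⟪x, z⟫ := fun z => by rw [hx, InnerProductSpace.toDual_symm_apply]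
  have hmem : (∑ j, (-(SignType.sign ⟪v j, x⟫ : ℝ) / 2) • v j) ∈ centredZonotope v := by
    refine mem_centredZonotope.2 ⟨_, fun j => ?_, rfl⟩
    rcases lt_trichotomy ⟪v j, x⟫ 0 with h | h | h
    · simp [h]
    · simp [h]
    · simp [h, abs_div]
  have h1 := hc _ hmem
  rw [hf, inner_sum] at h1
  have h2 : ∑ j, ⟪x, (-(SignType.sign ⟪v j, x⟫ : ℝ) / 2) • v j⟫ = -((∑ j, |⟪v j, x⟫|) / 2) := by
    rw [Finset.sum_div, ← Finset.sum_neg_distrib]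
    refine Finset.sum_congr rfl fun j _ => ?_
    rw [real_inner_smul_right, real_inner_comm (v j) x, ← sign_mul_self ⟪v j, x⟫]
    ring
  have h3 : -(R * ‖x‖) ≤ f y := by
    rw [hf]
    have := abs_le.1 (abs_real_inner_le_norm x y)
    have hy' : ‖y‖ ≤ R := mem_closedBall_zero_iff.1 hy
    nlinarith [norm_nonneg x, this.1]
  have := h x
  linarith

theorem tendsto_integral_norm_approxOn_sub_id [FiniteDimensional ℝ E]
    [MeasurableSpace E] [BorelSpace E] {μ : Measure E} [IsProbabilityMeasure μ] {R : ℝ}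
    (hR : ∀ᵐ u ∂μ, ‖u‖ ≤ R) :
    Filter.Tendsto (fun m => ∫ u, ‖SimpleFunc.approxOn (fun u : E => u) measurable_id Set.univ 0
      (Set.mem_univ _) m u - u‖ ∂μ) Filter.atTop (nhds 0) := by
  rw [← integral_zero E ℝ (μ := μ)]
  refine tendsto_integral_of_dominated_convergence (fun _ => 3 * R) ?_ (integrable_const _) ?_ ?_
  · intro m
    exact ((SimpleFunc.measurable _).sub measurable_id).norm.aestronglyMeasurable
  · intro m
    filter_upwards [hR] with u hu
    have := SimpleFunc.norm_approxOn_zero_le (f := fun u : E => u) measurable_id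
      (Set.mem_univ (0 : E)) u m
    rw [norm_norm]
    refine (norm_sub_le _ _).trans ?_
    linarith
  · filter_upwards with u
    have := SimpleFunc.tendsto_approxOn (f := fun u : E => u) measurable_id
      (Set.mem_univ (0 : E)) (x := u) (by simp)
    simpa using (this.sub_const u).norm

/-- The discretised support function of a zonoid. -/
theorem sum_range_abs_inner [MeasurableSpace E] {μ : Measure E} [IsProbabilityMeasure μ]
    (s : SimpleFunc E E) (x : E) :
    ∑ p : s.range, |⟪μ.real (s ⁻¹' {p.1}) • p.1, x⟫| = ∫ u, |⟪s u, x⟫| ∂μ := by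
  have h := SimpleFunc.integral_eq_integral (f := s.map fun z => |⟪z, x⟫|) (μ := μ)
    (SimpleFunc.integrable_of_isFiniteMeasure _)
  simp only [SimpleFunc.coe_map, Function.comp_apply] at h
  rw [← h, SimpleFunc.map_integral _ _ (SimpleFunc.integrable_of_isFiniteMeasure _) (by simp),
    Finset.univ_eq_attach, ← Finset.sum_attach s.range]
  refine Finset.sum_congr rfl fun p _ => ?_
  rw [real_inner_smul_left, abs_mul, abs_of_nonneg measureReal_nonneg, smul_eq_mul]

/-- Discretised integrals over a power of a probability space are finite sums. -/
theorem integral_pi_simpleFunc {E : Type*} [MeasurableSpace E] {κ : Type*} [Fintype κ]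
    [DecidableEq κ] {μ : Measure E}
    [IsProbabilityMeasure μ] (s : SimpleFunc E E) (F : (κ → E) → ℝ) :
    ∫ u, F (fun a => s (u a)) ∂(Measure.pi fun _ : κ => μ)
      = ∑ h : κ → s.range, (∏ a, μ.real (s ⁻¹' {(h a).1})) * F fun a => (h a).1 := by
  let _ : MeasurableSpace s.range := ⊤
  let p : E → s.range := fun u => ⟨s u, SimpleFunc.mem_range_self s u⟩
  have hp : Measurable p := by
    refine measurable_to_countable' fun z => ?_
    have : p ⁻¹' {z} = s ⁻¹' {z.1} := by
      ext u
      simp [p, Subtype.ext_iff]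
    rw [this]
    exact s.measurableSet_fiber _
  have := Measure.isProbabilityMeasure_map (μ := μ) hp.aemeasurable
  have h1 := Measure.pi_map_pi (ι := κ) (μ := fun _ => μ) (f := fun _ => p)
    fun _ => hp.aemeasurable
  have h2 : ∫ u, F (fun a => s (u a)) ∂(Measure.pi fun _ : κ => μ)
      = ∫ h : κ → s.range, F (fun a => (h a).1) ∂(Measure.pi fun _ : κ => μ.map p) := by
    rw [← h1, integral_map]
    · exact (measurable_pi_lambda _ fun a => hp.comp (measurable_pi_apply a)).aemeasurable
    · exact (measurable_of_countable _).aestronglyMeasurable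
  rw [h2, integral_fintype (Integrable.of_finite)]
  refine Finset.sum_congr rfl fun h _ => ?_
  rw [smul_eq_mul, Measure.real, Measure.pi_singleton, ENNReal.toReal_prod]
  congr 1
  refine Finset.prod_congr rfl fun a _ => ?_
  rw [Measure.map_apply hp (measurableSet_singleton _), Measure.real]
  congr 2
  ext u
  simp [p, Subtype.ext_iff]

theorem image_sum_ball_scaling {I κ : Type*} [Fintype I] [Fintype κ] (L : I → E →ₗ[ℝ] (κ → ℝ))
    {R : ℝ} (hR : 0 < R) :
    (fun b : I → E => ∑ i, L i (b i)) '' {b | ∀ i, b i ∈ closedBall 0 R}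
      = R • ((fun b : I → E => ∑ i, L i (b i)) '' {b | ∀ i, b i ∈ closedBall 0 1}) := by
  ext x
  simp only [Set.mem_smul_set, Set.mem_image, Set.mem_ofPred_eq, mem_closedBall_zero_iff]
  constructor
  · rintro ⟨b, hb, rfl⟩
    refine ⟨_, ⟨fun i => R⁻¹ • b i, fun i => ?_, rfl⟩, ?_⟩
    · rw [norm_smul, norm_inv, Real.norm_of_nonneg hR.le, inv_mul_le_iff₀ hR, mul_one]
      exact hb i
    · simp_rw [map_smul, ← Finset.smul_sum, smul_inv_smul₀ hR.ne']
  · rintro ⟨_, ⟨b, hb, rfl⟩, rfl⟩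
    refine ⟨fun i => R • b i, fun i => ?_, ?_⟩
    · rw [norm_smul, Real.norm_of_nonneg hR.le]
      exact mul_le_of_le_one_right hR.le (hb i)
    · simp_rw [map_smul, ← Finset.smul_sum]

theorem isCompact_image_sum_ball [FiniteDimensional ℝ E] {I κ : Type*} [Fintype I]
    (L : I → E →ₗ[ℝ] (κ → ℝ)) (R : ℝ) :
    IsCompact ((fun b : I → E => ∑ i, L i (b i)) '' {b | ∀ i, b i ∈ closedBall 0 R}) := by
  have h : {b : I → E | ∀ i, b i ∈ closedBall 0 R} = Set.pi Set.univ fun _ => closedBall 0 R := by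
    ext b
    simp
  rw [h]
  refine (isCompact_univ_pi fun _ => isCompact_closedBall _ _).image ?_
  exact continuous_finsetSum _ fun i _ =>
    (L i).continuous_of_finiteDimensional.comp (continuous_apply i)

theorem centredZonotope_sum_blocks {I P κ : Type*} [Fintype I] [Fintype P]
    (L : I → E →ₗ[ℝ] (κ → ℝ)) (v : P → E) :
    centredZonotope (fun q : I × P => L q.1 (v q.2))
      = (fun b : I → E => ∑ i, L i (b i)) '' {b | ∀ i, b i ∈ centredZonotope v} := by
  ext x
  simp only [Set.mem_image, Set.mem_ofPred_eq, mem_centredZonotope]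
  constructor
  · rintro ⟨t, ht, rfl⟩
    refine ⟨fun i => ∑ p, t (i, p) • v p, fun i => ⟨fun p => t (i, p), fun p => ht _, rfl⟩, ?_⟩
    simp [Fintype.sum_prod_type]
  · rintro ⟨b, hb, rfl⟩
    choose t ht h using hb
    refine ⟨fun q => t q.1 q.2, fun q => ht _ _, ?_⟩
    rw [Fintype.sum_prod_type]
    refine Finset.sum_congr rfl fun i _ => ?_
    simp [← h]

theorem continuous_abs_det_linear [FiniteDimensional ℝ E] {κ : Type*} [Fintype κ] [DecidableEq κ]
    (L : κ → E →ₗ[ℝ] (κ → ℝ)) :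
    Continuous fun u : κ → E => |(Matrix.of fun a => L a (u a)).det| := by
  refine continuous_abs.comp (Continuous.matrix_det ?_)
  exact continuous_pi fun a => (L a).continuous_of_finiteDimensional.comp (continuous_apply a)

theorem exists_bound_abs_det [FiniteDimensional ℝ E] {κ : Type*} [Fintype κ] [DecidableEq κ]
    (L : κ → E →ₗ[ℝ] (κ → ℝ)) (R : ℝ) :
    ∃ C, ∀ u : κ → E, (∀ a, ‖u a‖ ≤ R) → |(Matrix.of fun a => L a (u a)).det| ≤ C := by
  obtain ⟨C, hC⟩ := (isCompact_closedBall (0 : κ → E) |R|).bddAbove_image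
    (continuous_abs_det_linear L).continuousOn
  refine ⟨C, fun u hu => hC ⟨u, ?_, rfl⟩⟩
  rw [mem_closedBall_zero_iff, pi_norm_le_iff_of_nonneg (abs_nonneg _)]
  exact fun a => (hu a).trans (le_abs_self R)

theorem ae_pi_forall_norm_le {E : Type*} [NormedAddCommGroup E] [MeasurableSpace E] {κ : Type*} [Fintype κ] {μ : Measure E} [IsProbabilityMeasure μ]
    {R : ℝ} (hR : ∀ᵐ u ∂μ, ‖u‖ ≤ R) :
    ∀ᵐ u ∂(Measure.pi fun _ : κ => μ), ∀ a, ‖u a‖ ≤ R := by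
  rw [ae_all_iff]
  exact fun a => (Measure.quasiMeasurePreserving_eval (fun _ : κ => μ) a).ae hR

theorem volume_centredZonotope_blocks [MeasurableSpace E] {I κ : Type*} [Fintype I] [Fintype κ] [DecidableEq κ]
    {μ : Measure E} [IsProbabilityMeasure μ] (L : I → E →ₗ[ℝ] (κ → ℝ)) (s : SimpleFunc E E) :
    volume.real (centredZonotope fun q : I × s.range =>
        L q.1 (μ.real (s ⁻¹' {q.2.1}) • q.2.1))
      = (∑ g : κ → I, ∫ u, |(Matrix.of fun a => L (g a) (s (u a))).det|
          ∂(Measure.pi fun _ : κ => μ)) / (Fintype.card κ).factorial := by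
  rw [volume_centredZonotope, ← (Equiv.arrowProdEquivProdArrow κ (fun _ => I)
    (fun _ => s.range)).symm.sum_comp, Fintype.sum_prod_type]
  congr 1
  refine Finset.sum_congr rfl fun g _ => ?_
  rw [integral_pi_simpleFunc s fun u : κ → E => |(Matrix.of fun a => L (g a) (u a)).det|]
  refine Finset.sum_congr rfl fun h _ => ?_
  have hpos : 0 ≤ ∏ a, μ.real (s ⁻¹' {(h a).1}) :=
    Finset.prod_nonneg fun a _ => measureReal_nonneg
  rw [← abs_of_nonneg hpos, ← abs_mul, ← Matrix.det_mul_column]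
  congr 2
  ext a b
  simp [Equiv.arrowProdEquivProdArrow]

/-- If `μ` generates the unit ball as a zonoid, the volume of a Minkowski sum of linear images of
the ball is the sum of the mean absolute determinants of random generators. -/
theorem volume_sum_ball [FiniteDimensional ℝ E] [MeasurableSpace E] [BorelSpace E]
    {I κ : Type*} [Fintype I] [Fintype κ] [DecidableEq κ]
    {μ : Measure E} [IsProbabilityMeasure μ] {R : ℝ} (hR : ∀ᵐ u ∂μ, ‖u‖ ≤ R)
    (hμ : ∀ x : E, ∫ u, |⟪u, x⟫| ∂μ = 2 * ‖x‖) (L : I → E →ₗ[ℝ] (κ → ℝ)) :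
    volume.real ((fun b : I → E => ∑ i, L i (b i)) '' {b | ∀ i, b i ∈ closedBall 0 1})
      = (∑ g : κ → I, ∫ u, |(Matrix.of fun a => L (g a) (u a)).det|
          ∂(Measure.pi fun _ : κ => μ)) / (Fintype.card κ).factorial := by
  set K := (fun b : I → E => ∑ i, L i (b i)) '' {b | ∀ i, b i ∈ closedBall 0 1} with hK
  set N := Fintype.card κ
  set s : ℕ → SimpleFunc E E := fun m =>
    SimpleFunc.approxOn (fun u : E => u) measurable_id Set.univ 0 (Set.mem_univ _) m with hs
  set Z : (m : ℕ) → Set (κ → ℝ) := fun m => centredZonotope fun q : I × (s m).range =>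
    L q.1 (μ.real (s m ⁻¹' {q.2.1}) • q.2.1) with hZ
  set ε : ℕ → ℝ := fun m => ∫ u, ‖s m u - u‖ ∂μ with hε
  have hε0 : Filter.Tendsto ε Filter.atTop (nhds 0) := tendsto_integral_norm_approxOn_sub_id hR
  have hid : Integrable (fun u : E => u) μ :=
    Integrable.of_bound measurable_id.aestronglyMeasurable R hR
  have hinteg : ∀ m, Integrable (s m) μ := fun m => SimpleFunc.integrable_of_isFiniteMeasure _
  have hsupp : ∀ m x, |(∑ p : (s m).range, |⟪μ.real (s m ⁻¹' {p.1}) • p.1, x⟫|) / 2 - ‖x‖|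
      ≤ ε m * ‖x‖ := by
    intro m x
    have h1 : Integrable (fun u => |⟪s m u, x⟫|) μ := ((hinteg m).inner_const x).abs
    have h2 : Integrable (fun u => |⟪u, x⟫|) μ := (hid.inner_const x).abs
    have h3 : (∑ p : (s m).range, |⟪μ.real (s m ⁻¹' {p.1}) • p.1, x⟫|) / 2 - ‖x‖
        = (∫ u, (|⟪s m u, x⟫| - |⟪u, x⟫|) ∂μ) / 2 := by
      rw [sum_range_abs_inner, integral_sub h1 h2, hμ]
      ring
    have h4 : |∫ u, (|⟪s m u, x⟫| - |⟪u, x⟫|) ∂μ| ≤ ε m * ‖x‖ := by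
      rw [hε, ← integral_mul_const]
      refine (abs_integral_le_integral_abs).trans (integral_mono (h1.sub h2).abs
        (((hinteg m).sub hid).norm.mul_const _) fun u => ?_)
      refine (abs_abs_sub_abs_le_abs_sub _ _).trans ?_
      rw [← inner_sub_left]
      exact abs_real_inner_le_norm _ _
    rw [h3, abs_div, abs_two]
    have := abs_nonneg (∫ u, (|⟪s m u, x⟫| - |⟪u, x⟫|) ∂μ)
    linarith
  have hmono : ∀ {A B : Set E}, A ⊆ B →
      (fun b : I → E => ∑ i, L i (b i)) '' {b | ∀ i, b i ∈ A}
        ⊆ (fun b : I → E => ∑ i, L i (b i)) '' {b | ∀ i, b i ∈ B} :=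
    fun h => Set.image_mono fun b hb i => h (hb i)
  have hvolK : ∀ {c : ℝ}, 0 < c → volume.real (c • K) = c ^ N * volume.real K := by
    intro c hc
    rw [Measure.real, Measure.addHaar_smul, ENNReal.toReal_mul, ENNReal.toReal_ofReal (abs_nonneg _),
      abs_of_nonneg (by positivity), Module.finrank_fintype_fun_eq_card, Measure.real]
  have hKc : IsCompact K := isCompact_image_sum_ball L 1
  have hZc : ∀ m, IsCompact (Z m) := fun m => isCompact_centredZonotope _
  have hupper : ∀ m, volume.real (Z m) ≤ (1 + ε m) ^ N * volume.real K := by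
    intro m
    have hεm : 0 ≤ ε m := integral_nonneg fun u => norm_nonneg _
    rw [← hvolK (by linarith), hK, ← image_sum_ball_scaling L (by linarith)]
    refine measureReal_mono ?_ (isCompact_image_sum_ball L _).measure_ne_top
    simp only [hZ]
    rw [centredZonotope_sum_blocks L fun p : (s m).range => μ.real (s m ⁻¹' {p.1}) • p.1]
    refine hmono (centredZonotope_subset_closedBall (by linarith) fun x => ?_)
    have := abs_le.1 (hsupp m x)
    linarith [this.2]
  have hlower : ∀ᶠ m in Filter.atTop, (1 - ε m) ^ N * volume.real K ≤ volume.real (Z m) := by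
    filter_upwards [hε0.eventually_lt_const zero_lt_one] with m hm
    rw [← hvolK (by linarith), hK, ← image_sum_ball_scaling L (by linarith)]
    refine measureReal_mono ?_ (hZc m).measure_ne_top
    simp only [hZ]
    rw [centredZonotope_sum_blocks L fun p : (s m).range => μ.real (s m ⁻¹' {p.1}) • p.1]
    refine hmono (closedBall_subset_centredZonotope fun x => ?_)
    have := abs_le.1 (hsupp m x)
    linarith [this.1]
  have hlim1 : Filter.Tendsto (fun m => volume.real (Z m)) Filter.atTop
      (nhds (volume.real K)) := by
    refine tendsto_of_tendsto_of_tendsto_of_le_of_le' ?_ ?_ hlower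
      (Filter.Eventually.of_forall hupper)
    · simpa using ((hε0.const_sub 1).pow N).mul_const (volume.real K)
    · simpa using ((hε0.const_add 1).pow N).mul_const (volume.real K)
  refine tendsto_nhds_unique hlim1 ?_
  simp_rw [hZ, volume_centredZonotope_blocks]
  refine Filter.Tendsto.div_const (tendsto_finsetSum _ fun g _ => ?_) _
  obtain ⟨C, hC⟩ := exists_bound_abs_det (fun a => L (g a)) (2 * R)
  refine tendsto_integral_of_dominated_convergence (fun _ => C) ?_ (integrable_const _) ?_ ?_
  · intro m
    refine Measurable.aestronglyMeasurable ?_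
    have := (continuous_abs_det_linear fun a => L (g a)).measurable
    exact this.comp (measurable_pi_lambda _ fun a =>
      (SimpleFunc.measurable (s m)).comp (measurable_pi_apply a))
  · intro m
    filter_upwards [ae_pi_forall_norm_le hR] with u hu
    rw [Real.norm_eq_abs, abs_abs]
    refine hC (fun a => s m (u a)) fun a => ?_
    have := SimpleFunc.norm_approxOn_zero_le (f := fun u : E => u) measurable_id
      (Set.mem_univ (0 : E)) (u a) m
    refine this.trans ?_
    linarith [hu a]
  · filter_upwards with u
    have hc := (continuous_abs_det_linear fun a => L (g a)).tendsto u
    refine hc.comp (tendsto_pi_nhds.2 fun a => ?_)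
    exact SimpleFunc.tendsto_approxOn (f := fun u : E => u) measurable_id
      (Set.mem_univ (0 : E)) (x := u a) (by simp)

end Zonoid

section InvariantMeasures

open scoped RealInnerProductSpace

variable {E : Type*} [NormedAddCommGroup E] [InnerProductSpace ℝ E] [FiniteDimensional ℝ E]

theorem isCompact_unitary [CompleteSpace E] : IsCompact (unitary (E →L[ℝ] E) : Set (E →L[ℝ] E)) := by
  refine isCompact_of_isClosed_isBounded isClosed_unitary ?_
  refine (isBounded_closedBall (x := (0 : E →L[ℝ] E)) (r := 1)).subset fun A hA => ?_
  rw [mem_closedBall_zero_iff]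
  refine A.opNorm_le_bound zero_le_one fun x => ?_
  rw [one_mul]
  exact (Unitary.norm_map (⟨A, hA⟩ : unitary (E →L[ℝ] E)) x).le

/-- There is a random family of independent isometries whose law is invariant under composition
with isometries on the right. -/
theorem exists_random_isometries (I : Type*) [Fintype I] [CompleteSpace E] :
    ∃ η : @Measure (I → E →L[ℝ] E) (borel _), @IsProbabilityMeasure _ (borel _) η ∧
      (∀ᵐ O ∂η, ∀ i x, ‖O i x‖ = ‖x‖) ∧
      ∀ (Q : I → E ≃ₗᵢ[ℝ] E) (f : (I → E →L[ℝ] E) → ℝ), Continuous f →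
        ∫ O, f (fun i => (O i).comp ((Q i : E ≃L[ℝ] E) : E →L[ℝ] E)) ∂η = ∫ O, f O ∂η := by
  have := isCompact_iff_compactSpace.1 (isCompact_unitary (E := E))
  let G := I → unitary (E →L[ℝ] E)
  let _ : MeasurableSpace G := borel G
  have : BorelSpace G := ⟨rfl⟩
  let _ : MeasurableSpace (I → E →L[ℝ] E) := borel _
  have : BorelSpace (I → E →L[ℝ] E) := ⟨rfl⟩
  let ν : Measure G := Measure.haarMeasure ⊤
  have hν : IsProbabilityMeasure ν := ⟨by
    have := Measure.haarMeasure_self (K₀ := (⊤ : TopologicalSpace.PositiveCompacts G))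
    simpa using this⟩
  let F : G → I → E →L[ℝ] E := fun O i => ((O i)⁻¹ : unitary (E →L[ℝ] E))
  have hF : Continuous F := by
    refine continuous_pi fun i => ?_
    exact continuous_subtype_val.comp (continuous_inv.comp (continuous_apply i))
  refine ⟨ν.map F, Measure.isProbabilityMeasure_map hF.aemeasurable, ?_, ?_⟩
  · rw [ae_map_iff hF.aemeasurable]
    · filter_upwards with O i x
      exact Unitary.norm_map _ _
    · refine IsClosed.measurableSet ?_
      simp only [Set.ofPred_forall]
      refine isClosed_iInter fun i => isClosed_iInter fun x => isClosed_eq ?_ continuous_const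
      exact ((continuous_apply i).clm_apply continuous_const).norm
  · intro Q f hf
    have hc : Continuous fun O : I → E →L[ℝ] E =>
        fun i => (O i).comp ((Q i : E ≃L[ℝ] E) : E →L[ℝ] E) :=
      continuous_pi fun i => (continuous_apply i).clm_comp continuous_const
    have h1 := integral_map (μ := ν) hF.aemeasurable (hf.comp hc).aestronglyMeasurable
    simp only [Function.comp_apply] at h1
    rw [h1, integral_map hF.aemeasurable hf.aestronglyMeasurable]
    let q : G := fun i => (Unitary.linearIsometryEquiv.symm (Q i))⁻¹
    rw [← integral_mul_left_eq_self (fun O => f (F O)) q]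
    congr 1
    ext O
    congr 1
    ext i x
    have h2 : (q i * O i)⁻¹ = (O i)⁻¹ * Unitary.linearIsometryEquiv.symm (Q i) := by
      simp [q, mul_inv_rev]
    change _ = (((q i * O i)⁻¹ : unitary (E →L[ℝ] E)) : E →L[ℝ] E) x
    rw [h2]
    rfl

/-- A finite-dimensional unit ball is a zonoid, with a rotation invariant generating measure. -/
theorem exists_ball_generator [Nontrivial E] [MeasurableSpace E] [BorelSpace E] :
    ∃ μ : Measure E, IsProbabilityMeasure μ ∧ (∃ R, ∀ᵐ u ∂μ, ‖u‖ ≤ R) ∧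
      (∀ x, ∫ u, |⟪u, x⟫| ∂μ = 2 * ‖x‖) ∧ ∀ f : E ≃ₗᵢ[ℝ] E, MeasurePreserving f μ μ := by
  let B : Set E := closedBall 0 1
  let ν : Measure E := (volume B)⁻¹ • volume.restrict B
  have hB0 : volume B ≠ 0 := (measure_closedBall_pos _ _ one_pos).ne'
  have hBt : volume B ≠ ⊤ := (isCompact_closedBall _ _).measure_ne_top
  have hν : IsProbabilityMeasure ν := ⟨by simp [ν, ENNReal.inv_mul_cancel hB0 hBt]⟩
  have hle : ∀ᵐ u ∂ν, ‖u‖ ≤ 1 := by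
    refine Measure.ae_smul_measure ?_ _
    filter_upwards [ae_restrict_mem isClosed_closedBall.measurableSet] with u hu
    exact mem_closedBall_zero_iff.1 hu
  have hinv : ∀ f : E ≃ₗᵢ[ℝ] E, MeasurePreserving f ν ν := by
    intro f
    have h : MeasurePreserving f (volume.restrict B) (volume.restrict B) := by
      have := f.measurePreserving.restrict_preimage (s := B) isClosed_closedBall.measurableSet
      simpa [B] using this
    exact h.smul_measure _
  have hinteg : ∀ x, Integrable (fun u => |⟪u, x⟫|) ν := by
    intro x
    refine Integrable.of_bound (by fun_prop) ‖x‖ ?_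
    filter_upwards [hle] with u hu
    rw [Real.norm_eq_abs, abs_abs]
    exact (abs_real_inner_le_norm _ _).trans (mul_le_of_le_one_left (norm_nonneg _) hu)
  obtain ⟨e, he⟩ := exists_norm_eq E zero_le_one
  set c := ∫ u, |⟪u, e⟫| ∂ν with hc
  have hform : ∀ x, ∫ u, |⟪u, x⟫| ∂ν = c * ‖x‖ := by
    intro x
    let f : E ≃ₗᵢ[ℝ] E := (ℝ ∙ (‖x‖ • e - x))ᗮ.reflection
    have hf : f (‖x‖ • e) = x := Submodule.reflection_sub (by simp [norm_smul, he])
    have h1 := (hinv f).integral_comp f.toHomeomorph.measurableEmbedding fun u => |⟪u, x⟫|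
    rw [← h1, hc, ← integral_mul_const]
    congr 1
    ext u
    nth_rewrite 1 [← hf]
    rw [f.inner_map_map, real_inner_smul_right, abs_mul, abs_norm, mul_comm]
  have hc0 : 0 < c := by
    refine lt_of_le_of_ne (integral_nonneg fun u => abs_nonneg _) fun h => ?_
    have h1 := (integral_eq_zero_iff_of_nonneg (fun u => abs_nonneg _) (hinteg e)).1 h.symm
    have h2 : ∀ᵐ u ∂(volume.restrict B), ⟪u, e⟫ = 0 := by
      have h3 : volume.restrict B ≪ ν :=
        Measure.absolutelyContinuous_smul (ENNReal.inv_ne_zero.2 hBt)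
      filter_upwards [h3.ae_le h1] with u hu
      simpa using hu
    have h4 : volume (B ∩ (ℝ ∙ e)ᗮ) = 0 := by
      refine measure_mono_null Set.inter_subset_right (Measure.addHaar_submodule _ _ fun h => ?_)
      have : e ∈ (ℝ ∙ e)ᗮ := h ▸ Submodule.mem_top
      rw [Submodule.mem_orthogonal_singleton_iff_inner_right] at this
      simp [he] at this
    rw [ae_restrict_iff' isClosed_closedBall.measurableSet] at h2
    refine hB0 (measure_mono_null_ae ?_ h4)
    filter_upwards [h2] with u hu hB
    refine ⟨hB, ?_⟩
    rw [SetLike.mem_coe, Submodule.mem_orthogonal_singleton_iff_inner_left]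
    exact hu hB
  have hs : Measurable fun u : E => (2 / c) • u := measurable_const_smul _
  refine ⟨ν.map fun u => (2 / c) • u, Measure.isProbabilityMeasure_map hs.aemeasurable,
    ⟨2 / c, ?_⟩, fun x => ?_, fun f => ⟨f.continuous.measurable, ?_⟩⟩
  · rw [ae_map_iff hs.aemeasurable (isClosed_le continuous_norm continuous_const).measurableSet]
    filter_upwards [hle] with u hu
    rw [norm_smul, Real.norm_of_nonneg (by positivity)]
    exact mul_le_of_le_one_right (by positivity) hu
  · rw [integral_map hs.aemeasurable (by fun_prop)]
    simp_rw [real_inner_smul_left, abs_mul, integral_const_mul, hform]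
    rw [abs_of_pos (by positivity)]
    field_simp
  · rw [Measure.map_map f.continuous.measurable hs]
    conv_rhs => rw [← (hinv f).map_eq, Measure.map_map hs f.continuous.measurable]
    congr 1
    ext u
    simp

end InvariantMeasures

section FactorizedDeterminants

variable {E : Type*} [NormedAddCommGroup E] [InnerProductSpace ℝ E] [FiniteDimensional ℝ E]
  {ι : Type*} [Fintype ι] (e : OrthonormalBasis ι ℝ E)

theorem exists_isometry_mem_span {α : Type*} [Finite α] (u : α → E) {c : α → ι}
    (hc : Function.Injective c) :
    ∃ Q : E ≃ₗᵢ[ℝ] E, ∀ a, u a ∈ Submodule.span ℝ (Set.range fun b => Q (e (c b))) := by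
  have := Fintype.ofFinite α
  let W := Submodule.span ℝ (Set.range u)
  let bW := stdOrthonormalBasis ℝ W
  have hcard : Fintype.card (Fin (Module.finrank ℝ W)) ≤ Fintype.card α := by
    rw [Fintype.card_fin]
    exact finrank_range_le_card u
  obtain ⟨σ⟩ := Function.Embedding.nonempty_of_card_le hcard
  have hinj : Function.Injective (c ∘ σ) := hc.comp σ.injective
  let v : ι → E := Function.extend (c ∘ σ) (fun i => (bW i : E)) 0
  have hv : ∀ i, v (c (σ i)) = bW i := hinj.extend_apply _ _
  have horth : Orthonormal ℝ fun i => (bW i : E) := by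
    have := bW.orthonormal.comp_linearIsometry W.subtypeₗᵢ
    exact this
  have hs : Orthonormal ℝ ((Set.range (c ∘ σ)).domRestrict v) := by
    have h := horth.comp _ (Equiv.ofInjective _ hinj).symm.injective
    convert h using 1
    ext j
    obtain ⟨i, rfl⟩ := (Equiv.ofInjective _ hinj).surjective j
    simp only [Function.comp_apply, Equiv.symm_apply_apply]
    exact hv i
  obtain ⟨b, hb⟩ := hs.exists_orthonormalBasis_extension_of_card_eq
    (Module.finrank_eq_card_basis e.toBasis)
  refine ⟨e.equiv b (Equiv.refl ι), fun a => ?_⟩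
  have h1 : u a ∈ W := Submodule.subset_span ⟨a, rfl⟩
  have h2 : u a = ∑ i, (bW.repr ⟨u a, h1⟩ i) • (bW i : E) := by
    have := congrArg (fun w : W => (w : E)) (bW.sum_repr ⟨u a, h1⟩)
    simpa using this.symm
  rw [h2]
  refine Submodule.sum_mem _ fun i _ => Submodule.smul_mem _ _ (Submodule.subset_span ⟨σ i, ?_⟩)
  simp only [OrthonormalBasis.equiv_apply_basis, Equiv.refl_apply]
  exact (hb _ ⟨i, rfl⟩).trans (hv i)

theorem exists_blockwise_isometry {I κ : Type*} [Fintype κ] (g : κ → I) {c : κ → ι}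
    (hc : Function.Injective fun a => (g a, c a)) (u : κ → E) :
    ∃ (Q : I → E ≃ₗᵢ[ℝ] E) (R : Matrix κ κ ℝ), (∀ a b, g a ≠ g b → R a b = 0) ∧
      ∀ a, u a = ∑ b, R a b • Q (g a) (e (c b)) := by
  classical
  have h1 : ∀ i, ∃ Q : E ≃ₗᵢ[ℝ] E, ∀ a : {a // g a = i},
      u a ∈ Submodule.span ℝ (Set.range fun b : {a // g a = i} => Q (e (c b))) := by
    intro i
    refine exists_isometry_mem_span e (fun a : {a // g a = i} => u a) fun a b h => ?_
    exact Subtype.ext (hc (Prod.ext (a.2.trans b.2.symm) h))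
  choose Q hQ using h1
  simp only [Submodule.mem_span_range_iff_exists_fun] at hQ
  choose q hq using hQ
  refine ⟨Q, fun a b => if h : g b = g a then q (g a) ⟨a, rfl⟩ ⟨b, h⟩ else 0, ?_, fun a => ?_⟩
  · intro a b h
    exact dif_neg fun h' => h h'.symm
  · refine (hq (g a) ⟨a, rfl⟩).symm.trans ?_
    let F : κ → E := fun b =>
      (if h : g b = g a then q (g a) ⟨a, rfl⟩ ⟨b, h⟩ else 0) • Q (g a) (e (c b))
    have h1 : ∑ b with g b = g a, F b = ∑ b : {b // g b = g a}, F b :=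
      Finset.sum_subtype _ (by simp) F
    rw [Finset.sum_filter_of_ne fun b _ h => by by_contra h'; simp [F, h'] at h] at h1
    refine Eq.trans (Finset.sum_congr rfl fun b _ => ?_) h1.symm
    simp [F, b.2]

theorem det_blockwise {E : Type*} [NormedAddCommGroup E] [InnerProductSpace ℝ E]
    (e : OrthonormalBasis ι ℝ E) {I κ : Type*} [Fintype κ] [DecidableEq κ] (g : κ → I) {c : κ → ι}
    {u : κ → E} {Q : I → E ≃ₗᵢ[ℝ] E} {R : Matrix κ κ ℝ} (hR : ∀ a b, g a ≠ g b → R a b = 0)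
    (hu : ∀ a, u a = ∑ b, R a b • Q (g a) (e (c b))) (L : I → E →ₗ[ℝ] (κ → ℝ))
    (O : I → E →L[ℝ] E) :
    |(Matrix.of fun a => L (g a) (O (g a) (u a))).det|
      = |R.det| * |(Matrix.of fun a => L (g a)
          ((O (g a)).comp ((Q (g a) : E ≃L[ℝ] E) : E →L[ℝ] E) (e (c a)))).det| := by
  rw [← abs_mul, ← Matrix.det_mul]
  congr 2
  ext a j
  rw [Matrix.mul_apply, Matrix.of_apply, hu a]
  simp only [map_sum, map_smul, Finset.sum_apply, Pi.smul_apply, smul_eq_mul, Matrix.of_apply]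
  refine Finset.sum_congr rfl fun b _ => ?_
  by_cases h : g a = g b
  · simp [h]
  · simp [hR a b h]

theorem measurePreserving_pi_isometry [MeasurableSpace E] [BorelSpace E] {κ : Type*} [Fintype κ]
    {μ : Measure E} [IsProbabilityMeasure μ] (hμ : ∀ f : E ≃ₗᵢ[ℝ] E, MeasurePreserving f μ μ)
    (A : κ → E →L[ℝ] E) (hA : ∀ a x, ‖A a x‖ = ‖x‖) :
    MeasurePreserving (fun (u : κ → E) a => A a (u a)) (Measure.pi fun _ => μ)
      (Measure.pi fun _ => μ) := by
  refine measurePreserving_pi _ _ fun a => ?_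
  exact hμ (LinearIsometry.toLinearIsometryEquiv ⟨(A a : E →ₗ[ℝ] E), hA a⟩ rfl)

/-- Mean absolute determinants factor through the ones of random orthonormal vectors. -/
theorem exists_integral_det_eq_mul [MeasurableSpace E] [BorelSpace E] {I κ : Type*} [Fintype I]
    [Fintype κ] [DecidableEq κ] {μ : Measure E} [IsProbabilityMeasure μ] {R : ℝ}
    (hR : ∀ᵐ u ∂μ, ‖u‖ ≤ R) (hμ : ∀ f : E ≃ₗᵢ[ℝ] E, MeasurePreserving f μ μ)
    [MeasurableSpace (I → E →L[ℝ] E)] [BorelSpace (I → E →L[ℝ] E)]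
    {η : Measure (I → E →L[ℝ] E)} [IsProbabilityMeasure η]
    (hη : ∀ᵐ O ∂η, ∀ i x, ‖O i x‖ = ‖x‖)
    (hη' : ∀ (Q : I → E ≃ₗᵢ[ℝ] E) (f : (I → E →L[ℝ] E) → ℝ), Continuous f →
        ∫ O, f (fun i => (O i).comp ((Q i : E ≃L[ℝ] E) : E →L[ℝ] E)) ∂η = ∫ O, f O ∂η)
    (g : κ → I) {c : κ → ι} (hc : Function.Injective fun a => (g a, c a)) :
    ∃ ρ : ℝ, ∀ L : I → E →ₗ[ℝ] (κ → ℝ),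
      ∫ u, |(Matrix.of fun a => L (g a) (u a)).det| ∂(Measure.pi fun _ : κ => μ)
        = ρ * ∫ O, |(Matrix.of fun a => L (g a) (O (g a) (e (c a)))).det| ∂η := by
  have hcont : ∀ L : I → E →ₗ[ℝ] (κ → ℝ), Continuous fun p : (I → E →L[ℝ] E) × (κ → E) =>
      |(Matrix.of fun a => L (g a) (p.1 (g a) (p.2 a))).det| := by
    intro L
    refine (continuous_abs_det_linear fun a => L (g a)).comp (continuous_pi fun a => ?_)
    exact ((continuous_apply _).comp continuous_fst).clm_apply
      ((continuous_apply _).comp continuous_snd)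
  have hX : ∀ L : I → E →ₗ[ℝ] (κ → ℝ),
      ∫ u, |(Matrix.of fun a => L (g a) (u a)).det| ∂(Measure.pi fun _ : κ => μ)
        = ∫ u, ∫ O, |(Matrix.of fun a => L (g a) (O (g a) (u a))).det| ∂η
            ∂(Measure.pi fun _ : κ => μ) := by
    intro L
    rw [integral_integral_swap]
    · refine Eq.trans (b := ∫ _ : I → E →L[ℝ] E, ∫ u, |(Matrix.of fun a => L (g a) (u a)).det|
        ∂(Measure.pi fun _ : κ => μ) ∂η) (by simp) (integral_congr_ae ?_)
      filter_upwards [hη] with O hO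
      have hA := measurePreserving_pi_isometry hμ (fun a => O (g a)) fun a => hO (g a)
      have := integral_map (μ := Measure.pi fun _ : κ => μ) hA.measurable.aemeasurable
        (continuous_abs_det_linear fun a => L (g a)).aestronglyMeasurable
      rw [hA.map_eq] at this
      exact this
    · obtain ⟨C, hC⟩ := exists_bound_abs_det (fun a => L (g a)) R
      refine Integrable.of_bound ((hcont L).comp continuous_swap).aestronglyMeasurable C ?_
      filter_upwards [Measure.quasiMeasurePreserving_fst.ae (ae_pi_forall_norm_le hR),
        Measure.quasiMeasurePreserving_snd.ae hη] with p hp hp'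
      rw [Real.norm_eq_abs, Function.uncurry, abs_abs]
      refine hC _ fun a => ?_
      rw [hp']
      exact hp a
  have h : ∀ L : I → E →ₗ[ℝ] (κ → ℝ), Continuous fun O : I → E →L[ℝ] E =>
      |(Matrix.of fun a => L (g a) (O (g a) (e (c a)))).det| := fun L =>
    (hcont L).comp (continuous_id.prodMk (continuous_const (y := fun a => e (c a))))
  choose Q S hS hu using exists_blockwise_isometry e g hc
  have hX' : ∀ L : I → E →ₗ[ℝ] (κ → ℝ),
      ∫ u, |(Matrix.of fun a => L (g a) (u a)).det| ∂(Measure.pi fun _ : κ => μ)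
        = ∫ u, |(S u).det| * ∫ O, |(Matrix.of fun a => L (g a) (O (g a) (e (c a)))).det| ∂η
            ∂(Measure.pi fun _ : κ => μ) := by
    intro L
    rw [hX L]
    congr 1
    ext u
    simp_rw [det_blockwise e g (hS u) (hu u), integral_const_mul]
    rw [hη' (Q u) _ (h L)]
  exact ⟨_, fun L => (hX' L).trans (integral_mul_const _ _)⟩

end FactorizedDeterminants

section BlockDeterminants

theorem measurePreserving_fiberwise {E I κ : Type*} [Fintype I] [Fintype κ] [DecidableEq I]
    [MeasurableSpace E] (μ : Measure E) [SigmaFinite μ] (g : κ → I) :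
    MeasurePreserving (fun (v : (i : I) → {a // g a = i} → E) (a : κ) => v (g a) ⟨a, rfl⟩)
      (Measure.pi fun i => Measure.pi fun _ : {a // g a = i} => μ) (Measure.pi fun _ => μ) := by
  have hm : Measurable fun (v : (i : I) → {a // g a = i} → E) (a : κ) => v (g a) ⟨a, rfl⟩ :=
    measurable_pi_lambda _ fun a => (measurable_pi_apply _).comp (measurable_pi_apply (g a))
  refine ⟨hm, (Measure.pi_eq fun s hs => ?_).symm⟩
  rw [Measure.map_apply hm (MeasurableSet.univ_pi hs)]
  have h : (fun (v : (i : I) → {a // g a = i} → E) (a : κ) => v (g a) ⟨a, rfl⟩) ⁻¹'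
      Set.pi Set.univ s = Set.pi Set.univ fun i => Set.pi Set.univ fun a : {a // g a = i} => s a := by
    ext v
    simp only [Set.mem_preimage, Set.mem_pi, Set.mem_univ, true_implies]
    refine ⟨fun h i a => ?_, fun h a => h (g a) ⟨a, rfl⟩⟩
    obtain ⟨a, rfl⟩ := a
    exact h a
  rw [h, Measure.pi_pi]
  simp_rw [Measure.pi_pi]
  exact Fintype.prod_fiberwise g fun a => μ (s a)

theorem integral_pi_prod_fiberwise {E I κ : Type*} [Fintype I] [Fintype κ] [DecidableEq I]
    [MeasurableSpace E] (μ : Measure E) [SigmaFinite μ] (g : κ → I)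
    (F : (i : I) → ({a // g a = i} → E) → ℝ)
    (hF : AEStronglyMeasurable (fun u : κ → E => ∏ i, F i fun a => u a) (Measure.pi fun _ => μ)) :
    ∫ u : κ → E, ∏ i, F i (fun a => u a) ∂(Measure.pi fun _ => μ)
      = ∏ i, ∫ v, F i v ∂(Measure.pi fun _ : {a // g a = i} => μ) := by
  have h := measurePreserving_fiberwise μ g
  rw [← integral_fintype_prod_eq_prod, ← h.map_eq,
    integral_map h.measurable.aemeasurable (by rw [h.map_eq]; exact hF)]
  congr 1
  ext v
  refine Finset.prod_congr rfl fun i _ => congrArg (F i) (funext fun a => ?_)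
  obtain ⟨a, rfl⟩ := a
  rfl

theorem det_fiberwise {I κ : Type*} [Fintype I] [LinearOrder I] [Fintype κ] [DecidableEq κ]
    (g : κ → I) (M : Matrix κ κ ℝ) :
    (Matrix.of fun a b => if g b = g a then M a b else 0).det
      = ∏ i, (Matrix.of fun a b : {a // g a = i} => M a b).det := by
  have h : (Matrix.of fun a b => if g b = g a then M a b else 0).BlockTriangular g := by
    intro a b hab
    exact if_neg hab.ne
  rw [h.det_fintype]
  refine Finset.prod_congr rfl fun i _ => congrArg _ ?_
  ext a b
  simp [Matrix.toSquareBlock_def, a.2, b.2]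

end BlockDeterminants

section Omega

theorem omegaBall_pos (k : ℕ) : 0 < omegaBall k := by
  refine div_pos (Real.rpow_pos_of_pos Real.pi_pos _) (Real.Gamma_pos_of_pos (by positivity))

theorem volume_real_unitBall (α : Type*) [Fintype α] :
    volume.real (WithLp.ofLp '' closedBall (0 : EuclideanSpace ℝ α) 1)
      = omegaBall (Fintype.card α) := by
  cases isEmpty_or_nonempty α
  · have h : WithLp.ofLp '' closedBall (0 : EuclideanSpace ℝ α) 1 = {0} := by
      refine Set.eq_singleton_iff_unique_mem.2 ⟨⟨0, by simp, rfl⟩, fun x _ => Subsingleton.elim _ _⟩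
    rw [h, Measure.real, volume_pi, Measure.pi_of_empty _ 0]
    simp [omegaBall]
  · rw [Measure.real, ← (PiLp.volume_preserving_ofLp α).measure_preimage_emb
      (MeasurableEquiv.toLp 2 (α → ℝ)).symm.measurableEmbedding,
      Set.preimage_image_eq _ (WithLp.ofLp_injective 2), EuclideanSpace.volume_closedBall, omegaBall,
      ENNReal.ofReal_one, one_pow, one_mul, ENNReal.toReal_ofReal, Real.sqrt_eq_rpow,
      ← Real.rpow_natCast, ← Real.rpow_mul Real.pi_pos.le, add_comm]
    · ring_nf
    · have := Real.Gamma_pos_of_pos (s := (Fintype.card α : ℝ) / 2 + 1) (by positivity)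
      positivity

section UnitBlock

open scoped RealInnerProductSpace

variable {E : Type*} [NormedAddCommGroup E] [InnerProductSpace ℝ E] {ι : Type*} [Fintype ι]
  (e : OrthonormalBasis ι ℝ E)

/-- The coordinates of `x` along the basis vectors selected by `c`. -/
noncomputable def coordMap {α : Type*} (c : α → ι) : E →ₗ[ℝ] (α → ℝ) :=
  LinearMap.pi fun a => (innerSL ℝ (e (c a)) : E →ₗ[ℝ] ℝ)

theorem coordMap_apply {α : Type*} (c : α → ι) (x : E) (a : α) :
    coordMap e c x a = ⟪e (c a), x⟫ := rfl

theorem image_coordMap_unitBall {α : Type*} [Fintype α] {c : α → ι} (hc : Function.Injective c) :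
    coordMap e c '' closedBall 0 1 = WithLp.ofLp '' closedBall (0 : EuclideanSpace ℝ α) 1 := by
  have ho := e.orthonormal.comp c hc
  ext y
  constructor
  · rintro ⟨x, hx, rfl⟩
    refine ⟨WithLp.toLp 2 (coordMap e c x), ?_, rfl⟩
    rw [mem_closedBall_zero_iff] at hx ⊢
    rw [← sq_le_one_iff₀ (norm_nonneg _), EuclideanSpace.norm_sq_eq]
    refine (ho.sum_inner_products_le (s := Finset.univ) x).trans ?_
    exact pow_le_one₀ (norm_nonneg _) hx
  · rintro ⟨y, hy, rfl⟩
    refine ⟨∑ a, y a • e (c a), ?_, ?_⟩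
    · rw [mem_closedBall_zero_iff] at hy ⊢
      rw [← sq_le_one_iff₀ (norm_nonneg _)] at hy ⊢
      rw [EuclideanSpace.norm_sq_eq] at hy
      refine le_trans (le_of_eq ?_) hy
      have := ho.inner_sum (fun a => y a) (fun a => y a) Finset.univ
      simp only [Function.comp_apply] at this
      rw [← real_inner_self_eq_norm_sq, this]
      simp [sq]
    · ext a
      rw [coordMap_apply]
      exact ho.inner_right_fintype _ _

theorem integral_det_coordMap [FiniteDimensional ℝ E] [MeasurableSpace E] [BorelSpace E]
    {μ : Measure E} [IsProbabilityMeasure μ] {R : ℝ} (hR : ∀ᵐ u ∂μ, ‖u‖ ≤ R)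
    (hμ : ∀ x : E, ∫ u, |⟪u, x⟫| ∂μ = 2 * ‖x‖) {α : Type*} [Fintype α] [DecidableEq α]
    {c : α → ι} (hc : Function.Injective c) :
    ∫ u, |(Matrix.of fun a => coordMap e c (u a)).det| ∂(Measure.pi fun _ : α => μ)
      = (Fintype.card α).factorial * omegaBall (Fintype.card α) := by
  have h := volume_sum_ball hR hμ (fun _ : Unit => coordMap e c)
  have h1 : (fun b : Unit → E => ∑ i, coordMap e c (b i)) '' {b | ∀ i, b i ∈ closedBall 0 1}
      = coordMap e c '' closedBall 0 1 := by
    ext y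
    constructor
    · rintro ⟨b, hb, rfl⟩
      exact ⟨b (), hb _, by simp⟩
    · rintro ⟨x, hx, rfl⟩
      exact ⟨fun _ => x, fun _ => hx, by simp⟩
  rw [h1, image_coordMap_unitBall e hc, volume_real_unitBall, Fintype.sum_unique] at h
  rw [h]
  field_simp

end UnitBlock

end Omega

section ComplementaryMinors

theorem abs_det_toBlocks_eq {κ ι : Type*} [Fintype κ] [Fintype ι] [DecidableEq κ] [DecidableEq ι]
    {U V : Matrix (κ ⊕ ι) (κ ⊕ ι) ℝ} (h : U * V.transpose = 1) (hU : |U.det| = 1) :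
    |U.toBlocks₁₁.det| = |V.toBlocks₂₂.det| := by
  have h1 : U * Matrix.fromBlocks 1 V.toBlocks₂₁.transpose 0 V.toBlocks₂₂.transpose
      = Matrix.fromBlocks U.toBlocks₁₁ 0 U.toBlocks₂₁ 1 := by
    rw [← Matrix.fromBlocks_toBlocks U, ← Matrix.fromBlocks_toBlocks V,
      Matrix.fromBlocks_transpose, Matrix.fromBlocks_multiply, ← Matrix.fromBlocks_one,
      Matrix.fromBlocks_inj] at h
    nth_rewrite 1 [← Matrix.fromBlocks_toBlocks U]
    rw [Matrix.fromBlocks_multiply, h.2.1, h.2.2.2]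
    simp
  have h2 := congrArg Matrix.det h1
  rw [Matrix.det_mul, Matrix.det_fromBlocks_zero₂₁, Matrix.det_fromBlocks_zero₁₂, Matrix.det_one,
    Matrix.det_one, one_mul, mul_one, Matrix.det_transpose] at h2
  rw [← h2, abs_mul, hU, one_mul]

open scoped RealInnerProductSpace

variable {E : Type*} [NormedAddCommGroup E] [InnerProductSpace ℝ E] {ι : Type*} [Fintype ι]
  (e : OrthonormalBasis ι ℝ E)

/-- The block diagonal matrix of a family of linear maps. -/
noncomputable def blockMatrix {I : Type*} [DecidableEq I] (O : I → E →L[ℝ] E) :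
    Matrix (I × ι) (I × ι) ℝ :=
  Matrix.of fun p q => if q.1 = p.1 then ⟪e q.2, O p.1 (e p.2)⟫ else 0

theorem blockMatrix_submatrix_mul_transpose [DecidableEq ι] {I n : Type*} [DecidableEq I]
    [Fintype I] [Fintype n] [DecidableEq n] {O : I → E →L[ℝ] E} (hO : ∀ i x, ‖O i x‖ = ‖x‖)
    (ψ φ : n ≃ I × ι) :
    (blockMatrix e O).submatrix ψ φ * ((blockMatrix e O).submatrix ψ φ).transpose = 1 := by
  have h : blockMatrix e O * (blockMatrix e O).transpose = 1 := by
    ext p q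
    rw [Matrix.mul_apply, Fintype.sum_prod_type, Finset.sum_eq_single p.1]
    · simp only [blockMatrix, Matrix.of_apply, Matrix.transpose_apply, if_true]
      by_cases hpq : p.1 = q.1
      · have h1 := e.sum_inner_mul_inner (O p.1 (e p.2)) (O p.1 (e q.2))
        have h2 : ⟪O p.1 (e p.2), O p.1 (e q.2)⟫ = ⟪e p.2, e q.2⟫ :=
          LinearIsometry.inner_map_map ⟨(O p.1 : E →ₗ[ℝ] E), hO p.1⟩ _ _
        rw [h2, orthonormal_iff_ite.1 e.orthonormal] at h1
        simp only [hpq] at h1 ⊢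
        simp only [if_true, Matrix.one_apply, Prod.ext_iff, hpq, true_and]
        rw [← h1]
        refine Finset.sum_congr rfl fun k _ => ?_
        rw [real_inner_comm]
      · simp [hpq, Prod.ext_iff]
    · intro i _ hi
      simp [blockMatrix, hi]
    · simp
  rw [Matrix.transpose_submatrix, Matrix.submatrix_mul_equiv, h, Matrix.submatrix_one_equiv]

theorem abs_det_eq_one_of_mul_transpose {n : Type*} [Fintype n] [DecidableEq n] {U : Matrix n n ℝ}
    (h : U * U.transpose = 1) : |U.det| = 1 := by
  have := congrArg Matrix.det h
  rw [Matrix.det_mul, Matrix.det_transpose, Matrix.det_one] at this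
  rwa [← abs_mul_self, abs_mul, ← sq, pow_eq_one_iff_of_nonneg (abs_nonneg _) two_ne_zero] at this

/-- The coordinates of `x` in the block selected by `i`. -/
noncomputable def blockMap {I κ : Type*} [DecidableEq I] (g : κ → I) (c : κ → ι) (i : I) :
    E →ₗ[ℝ] (κ → ℝ) :=
  LinearMap.pi fun b => if g b = i then (innerSL ℝ (e (c b)) : E →ₗ[ℝ] ℝ) else 0

theorem blockMap_apply {I κ : Type*} [DecidableEq I] (g : κ → I) (c : κ → ι) (i : I) (x : E)
    (b : κ) : blockMap e g c i x b = if g b = i then ⟪e (c b), x⟫ else 0 := by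
  rw [blockMap, LinearMap.pi_apply]
  split_ifs <;> rfl

/-- The generators of the difference body map `(x, y₁, …, yₘ) ↦ (y₁ - x, …, yₘ - x)`. -/
noncomputable def diffMap (m : ℕ) (i : Fin (m + 1)) : E →ₗ[ℝ] (Fin m × ι → ℝ) :=
  LinearMap.pi fun p => (((if p.1.succ = i then 1 else 0) - (if 0 = i then 1 else 0) : ℝ)) •
    (innerSL ℝ (e p.2) : E →ₗ[ℝ] ℝ)

theorem diffMap_apply (m : ℕ) (i : Fin (m + 1)) (x : E) (p : Fin m × ι) :
    diffMap e m i x p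
      = ((if p.1.succ = i then 1 else 0) - (if 0 = i then 1 else 0)) * ⟪e p.2, x⟫ := rfl

theorem integral_det_blockMap [FiniteDimensional ℝ E] [MeasurableSpace E] [BorelSpace E]
    {I κ : Type*} [Fintype I] [LinearOrder I] [Fintype κ] [DecidableEq κ]
    {μ : Measure E} [IsProbabilityMeasure μ] {R : ℝ} (hR : ∀ᵐ u ∂μ, ‖u‖ ≤ R)
    (hμ : ∀ x : E, ∫ u, |⟪u, x⟫| ∂μ = 2 * ‖x‖) (g : κ → I) {c : κ → ι}
    (hc : Function.Injective fun a => (g a, c a)) :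
    ∫ u, |(Matrix.of fun a => blockMap e g c (g a) (u a)).det| ∂(Measure.pi fun _ : κ => μ)
      = ∏ i, ((Fintype.card {a // g a = i}).factorial * omegaBall (Fintype.card {a // g a = i})) := by
  have h : ∀ u : κ → E, |(Matrix.of fun a => blockMap e g c (g a) (u a)).det|
      = ∏ i, |(Matrix.of fun a : {a // g a = i} =>
          coordMap e (fun b : {a // g a = i} => c b) (u a)).det| := by
    intro u
    have h1 := det_fiberwise g (Matrix.of fun a b => ⟪e (c b), u a⟫)
    rw [← Finset.abs_prod]
    refine congrArg _ (Eq.trans ?_ h1)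
    congr 1
    ext a b
    simp [blockMap_apply]
  have hcont := continuous_abs_det_linear fun a : κ => blockMap e g c (g a)
  simp_rw [h] at hcont ⊢
  rw [integral_pi_prod_fiberwise μ g (fun i v => |(Matrix.of fun a : {a // g a = i} =>
          coordMap e (fun b : {a // g a = i} => c b) (v a)).det|) hcont.aestronglyMeasurable]
  refine Finset.prod_congr rfl fun i _ => integral_det_coordMap e hR hμ fun a b hab => ?_
  exact Subtype.ext (hc (Prod.ext (a.2.trans b.2.symm) hab))

variable {I κ : Type*} [Fintype κ] [DecidableEq κ] [DecidableEq ι]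

theorem abs_det_blockMap_eq [Fintype I] [DecidableEq I] {O : I → E →L[ℝ] E} (hO : ∀ i x, ‖O i x‖ = ‖x‖)
    {g : κ → I} {c : κ → ι} {g' : ι → I} {c' : ι → ι}
    (hb : Function.Bijective (Sum.elim (fun a => (g a, c a)) fun b => (g' b, c' b))) :
    |(Matrix.of fun a => blockMap e g c (g a) (O (g a) (e (c a)))).det|
      = |(Matrix.of fun a => blockMap e g' c' (g' a) (O (g' a) (e (c' a)))).det| := by
  let ψ : κ ⊕ ι ≃ I × ι := Equiv.ofBijective _ hb
  have h := blockMatrix_submatrix_mul_transpose e hO ψ ψ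
  have h1 := abs_det_toBlocks_eq h (abs_det_eq_one_of_mul_transpose h)
  convert h1 using 3
  · ext a b
    simp [blockMap_apply, blockMatrix, Matrix.toBlocks₁₁, ψ]
  · ext a b
    simp [blockMap_apply, blockMatrix, Matrix.toBlocks₂₂, ψ]

theorem abs_det_diffMap_eq {m : ℕ} {O : Fin (m + 1) → E →L[ℝ] E} (hO : ∀ i x, ‖O i x‖ = ‖x‖)
    {g : Fin m × ι → Fin (m + 1)} {c : Fin m × ι → ι} {g' : ι → Fin (m + 1)} {c' : ι → ι}
    (hb : Function.Bijective (Sum.elim (fun a => (g a, c a)) fun b => (g' b, c' b))) :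
    |(Matrix.of fun a => diffMap e m (g a) (O (g a) (e (c a)))).det|
      = |(Matrix.of fun a => coordMap e id (O (g' a) (e (c' a)))).det| := by
  let ψ : (Fin m × ι) ⊕ ι ≃ Fin (m + 1) × ι := Equiv.ofBijective _ hb
  let f : (Fin m × ι) ⊕ ι → Fin (m + 1) × ι :=
    Sum.elim (fun p => (p.1.succ, p.2)) fun j => (0, j)
  have hf : Function.Bijective f := by
    constructor
    · rintro (⟨i, j⟩ | j) (⟨i', j'⟩ | j') h <;>
        simp_all [f, Fin.succ_ne_zero, (Fin.succ_ne_zero _).symm, Prod.ext_iff]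
    · rintro ⟨i, j⟩
      refine Fin.cases ⟨Sum.inr j, rfl⟩ (fun i => ⟨Sum.inl (i, j), rfl⟩) i
  let φ : (Fin m × ι) ⊕ ι ≃ Fin (m + 1) × ι := Equiv.ofBijective f hf
  let C : Matrix ι (Fin m × ι) ℝ := Matrix.of fun j p => if p.2 = j then 1 else 0
  let N : Matrix ((Fin m × ι) ⊕ ι) ((Fin m × ι) ⊕ ι) ℝ := Matrix.fromBlocks 1 0 (-C) 1
  let M : Matrix ((Fin m × ι) ⊕ ι) ((Fin m × ι) ⊕ ι) ℝ := Matrix.fromBlocks 1 C.transpose 0 1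
  let P := (blockMatrix e O).submatrix ψ φ
  have hP : P * P.transpose = 1 := blockMatrix_submatrix_mul_transpose e hO ψ φ
  have hN : |N.det| = 1 := by simp [N]
  have hNM : N * M.transpose = 1 := by
    simp [N, M, Matrix.fromBlocks_transpose, Matrix.fromBlocks_multiply]
  have h : (P * N) * (P * M).transpose = 1 := by
    rw [Matrix.transpose_mul, Matrix.mul_assoc, ← Matrix.mul_assoc N, hNM, Matrix.one_mul, hP]
  have hdet : |(P * N).det| = 1 := by
    rw [Matrix.det_mul, abs_mul, hN, abs_det_eq_one_of_mul_transpose hP, one_mul]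
  have h1 := abs_det_toBlocks_eq h hdet
  convert h1 using 3
  · ext a ⟨i, j⟩
    simp [diffMap_apply, Matrix.toBlocks₁₁, Matrix.mul_apply, P, N, C, blockMatrix, ψ, φ, f,
      Matrix.one_apply]
    rw [Finset.sum_eq_single (i, j)]
    · rw [if_pos (Eq.refl (i, j))]
      split_ifs <;> simp
    · intro p _ hp
      simp [hp]
    · simp
  · ext a j
    simp [coordMap_apply, Matrix.toBlocks₂₂, Matrix.mul_apply, P, M, C, blockMatrix, ψ, φ, f,
      Matrix.one_apply]
    rw [Fintype.sum_prod_type]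
    refine Fin.cases ?_ (fun i => ?_) (g' a)
    · simp [Fin.succ_ne_zero]
    · simp [(Fin.succ_ne_zero _).symm, ← ite_and]
      simp [ite_and]

end ComplementaryMinors

section ColouredDeterminants

theorem exists_injective_prod_of_card_fiber_le {I κ ι : Type*} [Fintype κ] [Fintype ι]
    [DecidableEq I] (g : κ → I)
    (h : ∀ i, Fintype.card {a // g a = i} ≤ Fintype.card ι) :
    ∃ c : κ → ι, Function.Injective fun a => (g a, c a) := by
  have hf : ∀ i, Nonempty ({a // g a = i} ↪ ι) := fun i => Function.Embedding.nonempty_of_card_le (h i)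
  let f := fun i => (hf i).some
  refine ⟨fun a => f (g a) ⟨a, rfl⟩, fun a b hab => ?_⟩
  have key : ∀ i (ha : g a = i) (hb : g b = i), f i ⟨a, ha⟩ = f i ⟨b, hb⟩ → a = b :=
    fun i ha hb h => congrArg Subtype.val ((f i).injective h)
  have h1 : g a = g b := congrArg Prod.fst hab
  refine key (g b) h1 rfl ?_
  have h2 : f (g a) ⟨a, rfl⟩ = f (g b) ⟨b, rfl⟩ := congrArg Prod.snd hab
  rw [← h2]
  have h3 : ∀ i (ha : g a = i), f i ⟨a, ha⟩ = f (g a) ⟨a, rfl⟩ := by rintro _ rfl; rfl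
  exact h3 _ h1

theorem exists_complementary_colouring {I κ ι : Type*} [Fintype I] [Fintype κ] [Fintype ι]
    [DecidableEq I] [DecidableEq ι]
    (hcard : Fintype.card κ + Fintype.card ι = Fintype.card I * Fintype.card ι) {g : κ → I}
    {c : κ → ι} (hc : Function.Injective fun a => (g a, c a)) :
    ∃ (g' : ι → I) (c' : ι → ι),
      Function.Bijective (Sum.elim (fun a => (g a, c a)) fun b => (g' b, c' b)) ∧
      ∀ i, Fintype.card {b // g' b = i} = Fintype.card ι - Fintype.card {a // g a = i} := by
  classical
  let S := Set.range fun a => (g a, c a)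
  have h1 : Fintype.card (Sᶜ : Set (I × ι)) = Fintype.card ι := by
    rw [Fintype.card_compl_set, Fintype.card_prod, Set.card_range_of_injective hc]
    omega
  let f : ι ≃ (Sᶜ : Set (I × ι)) := (Fintype.equivOfCardEq h1).symm
  have hb : Function.Bijective (Sum.elim (fun a => (g a, c a))
      fun b => ((f b).1.1, (f b).1.2)) := by
    constructor
    · refine hc.sumElim (fun a b h => f.injective (Subtype.ext h)) fun a b h => (f b).2 ⟨a, h⟩
    · intro p
      by_cases hp : p ∈ S
      · obtain ⟨a, rfl⟩ := hp
        exact ⟨Sum.inl a, rfl⟩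
      · exact ⟨Sum.inr (f.symm ⟨p, hp⟩), by simp⟩
  refine ⟨fun b => (f b).1.1, fun b => (f b).1.2, hb, fun i => ?_⟩
  have h2 := (Equiv.ofBijective _ hb).sum_comp fun p : I × ι => if p.1 = i then 1 else 0
  rw [Fintype.sum_sum_type, Fintype.sum_prod_type, Finset.sum_eq_single i] at h2
  · simp only [Equiv.ofBijective_apply, Sum.elim_inl, Sum.elim_inr, if_true, Finset.sum_const,
      Finset.card_univ, smul_eq_mul, mul_one, Finset.sum_boole, Nat.cast_id] at h2
    rw [Fintype.card_subtype, Fintype.card_subtype]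
    simp only [] at h2 ⊢
    omega
  · intro j _ hj
    simp [hj]
  · simp

open scoped RealInnerProductSpace

variable {E : Type*} [NormedAddCommGroup E] [InnerProductSpace ℝ E] {ι : Type*} [Fintype ι]
  (e : OrthonormalBasis ι ℝ E)

theorem det_linear_eq_zero_of_card_fiber {I κ : Type*} [Fintype κ] [DecidableEq κ] [DecidableEq I]
    [FiniteDimensional ℝ E] (L : I → E →ₗ[ℝ] (κ → ℝ)) (g : κ → I) {i : I}
    (hi : Module.finrank ℝ E < Fintype.card {a // g a = i}) (u : κ → E) :
    (Matrix.of fun a => L (g a) (u a)).det = 0 := by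
  by_contra h
  have h1 := Matrix.linearIndependent_rows_of_det_ne_zero h
  have h2 := h1.comp (Subtype.val : {a // g a = i} → κ) Subtype.val_injective
  have h3 : LinearIndependent ℝ fun a : {a // g a = i} => u a := by
    refine LinearIndependent.of_comp (L i) ?_
    have h4 : (L i ∘ fun a : {a // g a = i} => u a)
        = (fun a => L (g a) (u a)) ∘ (Subtype.val : {a // g a = i} → κ) := by
      ext1 a
      change L i (u a) = L (g a) (u a)
      rw [a.2]
    rw [h4]
    exact h2
  exact absurd h3.fintype_card_le_finrank (not_le.2 hi)

theorem integral_det_diffMap [FiniteDimensional ℝ E] [Nontrivial E] [MeasurableSpace E]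
    [BorelSpace E] [DecidableEq ι] {μ : Measure E} [IsProbabilityMeasure μ] {R : ℝ}
    (hR : ∀ᵐ u ∂μ, ‖u‖ ≤ R) (hμ : ∀ x : E, ∫ u, |⟪u, x⟫| ∂μ = 2 * ‖x‖)
    (hμ' : ∀ f : E ≃ₗᵢ[ℝ] E, MeasurePreserving f μ μ) {m : ℕ} (g : Fin m × ι → Fin (m + 1))
    (hg : ∀ i, Fintype.card {a // g a = i} ≤ Fintype.card ι) :
    ∫ u, |(Matrix.of fun a => diffMap e m (g a) (u a)).det|
        ∂(Measure.pi fun _ : Fin m × ι => μ)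
      = (∏ i, ((Fintype.card {a // g a = i}).factorial *
            omegaBall (Fintype.card {a // g a = i}))) *
          ((Fintype.card ι).factorial * omegaBall (Fintype.card ι)) /
        ∏ i, ((Fintype.card ι - Fintype.card {a // g a = i}).factorial *
            omegaBall (Fintype.card ι - Fintype.card {a // g a = i})) := by
  obtain ⟨c, hc⟩ := exists_injective_prod_of_card_fiber_le g hg
  obtain ⟨g', c', hb, hg'⟩ := exists_complementary_colouring
    (by simp only [Fintype.card_prod, Fintype.card_fin]; ring) hc
  have hc' : Function.Injective fun b => (g' b, c' b) :=
    fun a b h => Sum.inr_injective (hb.1 h)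
  let _ : MeasurableSpace (Fin (m + 1) → E →L[ℝ] E) := borel _
  have : BorelSpace (Fin (m + 1) → E →L[ℝ] E) := ⟨rfl⟩
  obtain ⟨η, hη₀, hη, hη'⟩ := exists_random_isometries (E := E) (Fin (m + 1))
  obtain ⟨ρ, hρ⟩ := exists_integral_det_eq_mul e hR hμ' hη hη' g hc
  obtain ⟨ρ', hρ'⟩ := exists_integral_det_eq_mul e hR hμ' hη hη' g' hc'
  have hp : ∫ O, |(Matrix.of fun a => diffMap e m (g a) (O (g a) (e (c a)))).det| ∂η
      = ∫ O, |(Matrix.of fun a => coordMap e id (O (g' a) (e (c' a)))).det| ∂η :=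
    integral_congr_ae (hη.mono fun O hO => abs_det_diffMap_eq e hO hb)
  have hq : ∫ O, |(Matrix.of fun a => blockMap e g c (g a) (O (g a) (e (c a)))).det| ∂η
      = ∫ O, |(Matrix.of fun a => blockMap e g' c' (g' a) (O (g' a) (e (c' a)))).det| ∂η :=
    integral_congr_ae (hη.mono fun O hO => abs_det_blockMap_eq e hO hb)
  have hX := hρ (diffMap e m)
  have hK := hρ (blockMap e g c)
  have hY := hρ' fun _ => coordMap e id
  have hJ := hρ' (blockMap e g' c')
  rw [integral_det_blockMap e hR hμ g hc] at hK
  rw [integral_det_blockMap e hR hμ g' hc'] at hJ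
  rw [integral_det_coordMap e hR hμ Function.injective_id] at hY
  have hpos : (0 : ℝ) < ∏ i, ((Fintype.card {b // g' b = i}).factorial *
      omegaBall (Fintype.card {b // g' b = i})) :=
    Finset.prod_pos fun i _ => mul_pos (by positivity) (omegaBall_pos _)
  simp_rw [← hg']
  rw [eq_div_iff hpos.ne', hX]
  refine Eq.trans (congrArg _ hJ) ?_
  refine Eq.trans ?_ (congrArg₂ (· * ·) hK hY).symm
  rw [hp, hq]
  ring

end ColouredDeterminants

section FiberCounts

theorem card_fiber_counts_eq_multinomial {I κ : Type*} [Fintype I] [DecidableEq I] [Fintype κ]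
    [DecidableEq κ] {k : I → ℕ} (hk : k ∈ Finset.univ.piAntidiag (Fintype.card κ)) :
    (Finset.univ.filter fun g : κ → I => (fun i => Fintype.card {a // g a = i}) = k).card
      = Nat.multinomial Finset.univ k := by
  let M : (I → ℕ) → (I →₀ ℕ) := Finsupp.equivFunOnFinite.symm
  have hM : ∀ l : I → ℕ, ∏ i, (MvPolynomial.X i : MvPolynomial I ℕ) ^ l i
      = MvPolynomial.monomial (M l) 1 := by
    intro l
    rw [MvPolynomial.monomial_eq, Finsupp.prod_fintype _ _ fun i => pow_zero _]
    simp [M]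
  have hinj : ∀ l, M l = M k ↔ l = k := fun l => Finsupp.equivFunOnFinite.symm.injective.eq_iff
  have h1 := Finset.sum_pow_eq_sum_piAntidiag Finset.univ
    (fun i => (MvPolynomial.X i : MvPolynomial I ℕ)) (Fintype.card κ)
  have h2 : (∑ i, (MvPolynomial.X i : MvPolynomial I ℕ)) ^ Fintype.card κ
      = ∑ g : κ → I, ∏ i, (MvPolynomial.X i : MvPolynomial I ℕ) ^ Fintype.card {a // g a = i} := by
    rw [← Finset.card_univ, ← Finset.prod_const, Finset.prod_univ_sum, Fintype.piFinset_univ]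
    refine Finset.sum_congr rfl fun g _ => ?_
    rw [← Fintype.prod_fiberwise g fun a => (MvPolynomial.X (g a) : MvPolynomial I ℕ)]
    refine Finset.prod_congr rfl fun i _ => ?_
    rw [Finset.prod_congr rfl fun a _ => congrArg MvPolynomial.X a.2, Finset.prod_const,
      Finset.card_univ]
  rw [h2] at h1
  have h3 := congrArg (MvPolynomial.coeff (M k)) h1
  simp_rw [hM, MvPolynomial.coeff_sum, ← map_natCast (MvPolynomial.C (σ := I) (R := ℕ)),
    MvPolynomial.coeff_C_mul, MvPolynomial.coeff_monomial, hinj] at h3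
  rw [Finset.sum_boole] at h3
  simpa [hk] using h3

theorem sum_fiber_counts {I κ : Type*} [Fintype I] [DecidableEq I] [Fintype κ] [DecidableEq κ]
    (F : (I → ℕ) → ℝ) :
    (∑ g : κ → I, F fun i => Fintype.card {a // g a = i}) / (Fintype.card κ).factorial
      = ∑ k ∈ Finset.univ.piAntidiag (Fintype.card κ), F k / ∏ i, ((k i).factorial : ℝ) := by
  have hmaps : ∀ g ∈ (Finset.univ : Finset (κ → I)),
      (fun i => Fintype.card {a // g a = i}) ∈ Finset.univ.piAntidiag (Fintype.card κ) := by
    intro g _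
    simp only [Finset.mem_piAntidiag, Finset.mem_univ, implies_true, and_true]
    rw [← Fintype.card_sigma]
    exact Fintype.card_congr (Equiv.sigmaFiberEquiv g)
  rw [← Finset.sum_fiberwise_of_maps_to hmaps, Finset.sum_div]
  refine Finset.sum_congr rfl fun k hk => ?_
  rw [Finset.sum_congr rfl fun g hg => congrArg F (Finset.mem_filter.1 hg).2, Finset.sum_const,
    card_fiber_counts_eq_multinomial hk, nsmul_eq_mul]
  have h1 := Nat.multinomial_spec Finset.univ k
  rw [(Finset.mem_piAntidiag.1 hk).1] at h1
  have h2 : (∏ i, ((k i).factorial : ℝ)) * Nat.multinomial Finset.univ k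
      = (Fintype.card κ).factorial := by exact_mod_cast h1
  rw [div_eq_div_iff (by positivity) (Finset.prod_ne_zero_iff.2 fun i _ => by positivity), ← h2]
  ring

end FiberCounts

section DifferenceBody

open scoped RealInnerProductSpace

variable {E : Type*} [NormedAddCommGroup E] [InnerProductSpace ℝ E] {ι : Type*} [Fintype ι]
  [DecidableEq ι] (e : OrthonormalBasis ι ℝ E)

/-- The contribution to the volume of the difference body of balls of the terms in which the
ball of index `i` has degree `k i`. -/
noncomputable def ballMixedTerm {I : Type*} [Fintype I] (d : ℕ) (r : I → ℝ) (k : I → ℕ) : ℝ :=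
  (∏ i, r i ^ k i * omegaBall (k i)) * (d.factorial * omegaBall d) /
    ∏ i, ((d - k i).factorial * omegaBall (d - k i))

theorem volume_real_difference_body [FiniteDimensional ℝ E] [Nontrivial E] {m : ℕ}
    {r : Fin (m + 1) → ℝ} (hr : ∀ i, 0 < r i) :
    volume.real ((fun b : Fin (m + 1) → E => ∑ i, (r i • diffMap e m i) (b i)) ''
        {b | ∀ i, b i ∈ closedBall 0 1})
      = ∑ k ∈ (Finset.univ.piAntidiag (m * Fintype.card ι)).filter
          (fun k : Fin (m + 1) → ℕ => ∀ i, k i ≤ Fintype.card ι),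
          ballMixedTerm (Fintype.card ι) r k := by
  borelize E
  obtain ⟨μ, hμ₀, ⟨R, hR⟩, hμ, hμ'⟩ := exists_ball_generator (E := E)
  rw [volume_sum_ball hR hμ]
  let F : (Fin (m + 1) → ℕ) → ℝ := fun k => if ∀ i, k i ≤ Fintype.card ι then
    ballMixedTerm (Fintype.card ι) r k * ∏ i, ((k i).factorial : ℝ) else 0
  have hterm : ∀ g : Fin m × ι → Fin (m + 1),
      ∫ u, |(Matrix.of fun a => (r (g a) • diffMap e m (g a)) (u a)).det|
          ∂(Measure.pi fun _ : Fin m × ι => μ)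
        = F fun i => Fintype.card {a // g a = i} := by
    intro g
    simp only [F]
    have hscale : ∀ u : Fin m × ι → E,
        |(Matrix.of fun a => (r (g a) • diffMap e m (g a)) (u a)).det|
          = (∏ i, r i ^ Fintype.card {a // g a = i}) *
            |(Matrix.of fun a => diffMap e m (g a) (u a)).det| := by
      intro u
      have h1 := Matrix.det_mul_column (fun a => r (g a))
        (Matrix.of fun a => diffMap e m (g a) (u a))
      have h2 : ∏ a, r (g a) = ∏ i, r i ^ Fintype.card {a // g a = i} := by
        rw [← Fintype.prod_fiberwise g fun a => r (g a)]
        refine Finset.prod_congr rfl fun i _ => ?_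
        rw [Finset.prod_congr rfl fun a _ => congrArg r a.2, Finset.prod_const, Finset.card_univ]
      rw [← h2, ← abs_of_pos (Finset.prod_pos fun a _ => hr (g a)), ← abs_mul, ← h1]
      rfl
    simp_rw [hscale, integral_const_mul]
    split_ifs with hg
    · rw [integral_det_diffMap e hR hμ hμ' g hg, ballMixedTerm]
      simp only [Finset.prod_mul_distrib]
      ring
    · push Not at hg
      obtain ⟨i, hi⟩ := hg
      rw [← Module.finrank_eq_card_basis e.toBasis] at hi
      simp [det_linear_eq_zero_of_card_fiber (diffMap e m) g hi]
  rw [Finset.sum_congr rfl fun g _ => hterm g]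
  refine (sum_fiber_counts F).trans ?_
  rw [Fintype.card_prod, Fintype.card_fin, Finset.sum_filter]
  refine Finset.sum_congr rfl fun k _ => ?_
  simp only [F]
  split_ifs
  · rw [mul_div_cancel_right₀ _ (Finset.prod_ne_zero_iff.2 fun i _ => by positivity)]
  · simp

end DifferenceBody

section Assembly

theorem measurePreserving_uncurry_euclidean (m d : ℕ) :
    MeasurePreserving (fun (T : Fin m → EuclideanSpace ℝ (Fin d)) (p : Fin m × Fin d) => T p.1 p.2)
      volume volume := by
  have h1 : MeasurePreserving
      (fun (T : Fin m → EuclideanSpace ℝ (Fin d)) i => WithLp.ofLp (T i)) volume volume :=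
    volume_preserving_pi fun _ => PiLp.volume_preserving_ofLp (Fin d)
  have hm : Measurable fun (T : Fin m → Fin d → ℝ) (p : Fin m × Fin d) => T p.1 p.2 := by
    fun_prop
  refine MeasurePreserving.comp (g := fun (T : Fin m → Fin d → ℝ) (p : Fin m × Fin d) => T p.1 p.2)
    ⟨hm, (Measure.pi_eq fun s hs => ?_).symm⟩ h1
  rw [Measure.map_apply hm (MeasurableSet.univ_pi hs)]
  have h2 : (fun (T : Fin m → Fin d → ℝ) (p : Fin m × Fin d) => T p.1 p.2) ⁻¹' Set.pi Set.univ s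
      = Set.pi Set.univ fun i => Set.pi Set.univ fun j => s (i, j) := by
    ext T
    simp [Set.mem_pi]
  rw [h2, volume_pi_pi, Fintype.prod_prod_type]
  simp_rw [volume_pi_pi]

theorem setOf_inter_closedBall_ne_empty_eq {m d : ℕ} (t₁ : EuclideanSpace ℝ (Fin d))
    {r : Fin (m + 1) → ℝ} (hr : ∀ i, 0 < r i) :
    {T : Fin m → EuclideanSpace ℝ (Fin d) |
        closedBall t₁ (r 0) ∩ ⋂ i, closedBall (T i) (r i.succ) ≠ ∅}
      = (fun T => T - fun _ => t₁) ⁻¹' ((fun T (p : Fin m × Fin d) => T p.1 p.2) ⁻¹'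
          ((fun b : Fin (m + 1) → EuclideanSpace ℝ (Fin d) =>
              ∑ i, (r i • diffMap (EuclideanSpace.basisFun (Fin d) ℝ) m i) (b i)) ''
            {b | ∀ i, b i ∈ closedBall 0 1})) := by
  have hL : ∀ (b : Fin (m + 1) → EuclideanSpace ℝ (Fin d)) (p : Fin m × Fin d),
      (∑ i, (r i • diffMap (EuclideanSpace.basisFun (Fin d) ℝ) m i) (b i)) p
        = (r p.1.succ • b p.1.succ - r 0 • b 0) p.2 := by
    intro b p
    simp [Finset.sum_apply, diffMap_apply, sub_mul, mul_sub, Finset.sum_sub_distrib,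
      EuclideanSpace.inner_single_left]
  ext T
  simp only [Set.mem_ofPred_eq, ← Set.nonempty_iff_ne_empty, Set.mem_preimage, Set.mem_image]
  constructor
  · rintro ⟨x, hx₀, hx⟩
    rw [Set.mem_iInter] at hx
    refine ⟨Fin.cons ((r 0)⁻¹ • (t₁ - x)) fun i => (r i.succ)⁻¹ • (T i - x), fun i => ?_, ?_⟩
    · refine Fin.cases ?_ (fun i => ?_) i
      · rw [Fin.cons_zero, mem_closedBall_zero_iff, norm_smul, norm_inv, Real.norm_of_nonneg (hr 0).le,
          inv_mul_le_one₀ (hr 0), ← dist_eq_norm, dist_comm]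
        exact hx₀
      · rw [Fin.cons_succ, mem_closedBall_zero_iff, norm_smul, norm_inv,
          Real.norm_of_nonneg (hr _).le, inv_mul_le_one₀ (hr _), ← dist_eq_norm, dist_comm]
        exact hx i
    · ext p
      rw [hL, Fin.cons_zero, Fin.cons_succ, smul_inv_smul₀ (hr _).ne', smul_inv_smul₀ (hr _).ne']
      simp
  · rintro ⟨b, hb, hbT⟩
    have hT : ∀ i, T i - t₁ = r i.succ • b i.succ - r 0 • b 0 := by
      intro i
      ext j
      have := congrFun hbT (i, j)
      rw [hL] at this
      exact this.symm
    have hnorm : ∀ i, ‖r i • b i‖ ≤ r i := by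
      intro i
      rw [norm_smul, Real.norm_of_nonneg (hr i).le]
      exact mul_le_of_le_one_right (hr i).le (mem_closedBall_zero_iff.1 (hb i))
    refine ⟨t₁ - r 0 • b 0, ?_, Set.mem_iInter.2 fun i => ?_⟩
    · rw [mem_closedBall, dist_eq_norm, sub_sub_cancel_left, norm_neg]
      exact hnorm 0
    · have : T i = t₁ - r 0 • b 0 + r i.succ • b i.succ := by
        rw [eq_add_of_sub_eq (hT i)]
        abel
      rw [mem_closedBall, dist_comm, dist_eq_norm, this, add_sub_cancel_left]
      exact hnorm _

theorem volume_setOf_inter_closedBall_ne_empty {m d : ℕ} (hd : 1 ≤ d)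
    (t₁ : EuclideanSpace ℝ (Fin d)) {r : Fin (m + 1) → ℝ} (hr : ∀ i, 0 < r i) :
    volume {T : Fin m → EuclideanSpace ℝ (Fin d) |
        closedBall t₁ (r 0) ∩ ⋂ i, closedBall (T i) (r i.succ) ≠ ∅}
      = ENNReal.ofReal (∑ k ∈ (Finset.univ.piAntidiag (m * d)).filter
          (fun k : Fin (m + 1) → ℕ => ∀ i, k i ≤ d), ballMixedTerm d r k) := by
  have : Nonempty (Fin d) := ⟨⟨0, hd⟩⟩
  have hK := isCompact_image_sum_ball
    (fun i => r i • diffMap (EuclideanSpace.basisFun (Fin d) ℝ) m i) 1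
  have hvol := volume_real_difference_body (EuclideanSpace.basisFun (Fin d) ℝ) hr
  rw [Fintype.card_fin] at hvol
  have hΦ := measurePreserving_uncurry_euclidean m d
  rw [setOf_inter_closedBall_ne_empty_eq t₁ hr,
    (measurePreserving_sub_right volume fun _ => t₁).measure_preimage
      (hΦ.measurable hK.measurableSet).nullMeasurableSet,
    hΦ.measure_preimage hK.measurableSet.nullMeasurableSet, ← hvol,
    ofReal_measureReal hK.measure_ne_top]

theorem mul_le_sum_filter_ge {m : ℕ} (d : ℕ) (k : Fin m → ℕ) (hk : ∀ i, k i ≤ d)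
    (h : (m - 1) * d ≤ ∑ i, k i) (j : Fin m) :
    (m - 1 - j) * d ≤ ∑ i ∈ Finset.univ.filter (fun i => j ≤ i), k i := by
  have h1 := Finset.sum_filter_add_sum_filter_not Finset.univ (fun i => j ≤ i) k
  have h2 : ∑ i ∈ Finset.univ.filter (fun i => ¬ j ≤ i), k i ≤ j * d := by
    refine (Finset.sum_le_card_nsmul _ _ d fun i _ => hk i).trans (le_of_eq ?_)
    simp only [not_le, smul_eq_mul]
    rw [Finset.filter_gt_eq_Iio, Fin.card_Iio]
  rw [Nat.sub_mul (m - 1)]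
  omega

theorem sum_ballMixedTerm_eq {m : ℕ} (d : ℕ) (r : Fin (m + 2) → ℝ) :
    ∑ k ∈ (Finset.univ.piAntidiag ((m + 1) * d)).filter
        (fun k : Fin (m + 2) → ℕ => ∀ i, k i ≤ d), ballMixedTerm d r k
      = ∑ k ∈ Finset.univ.filter (fun k : Fin (m + 1) → Fin (d + 1) => ∀ j : Fin (m + 1),
            (m - j) * d ≤ ∑ i ∈ Finset.univ.filter (fun i => j ≤ i), (k i : ℕ)),
          ballMixedTerm d r (Fin.cons ((m + 1) * d - ∑ i, (k i : ℕ)) fun i => (k i : ℕ)) := by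
  symm
  have hle : ∀ k : Fin (m + 1) → Fin (d + 1), ∑ i, (k i : ℕ) ≤ (m + 1) * d := by
    intro k
    refine (Finset.sum_le_card_nsmul _ _ d fun i _ => Fin.is_le _).trans (le_of_eq ?_)
    simp
  refine Finset.sum_bij
    (fun k _ => Fin.cons ((m + 1) * d - ∑ i, (k i : ℕ)) fun i => (k i : ℕ)) ?_ ?_ ?_ fun _ _ => rfl
  · intro k hk
    have h0 := (Finset.mem_filter.1 hk).2 0
    simp only [Fin.zero_le, Finset.filter_true, Fin.val_zero, Nat.sub_zero] at h0
    simp only [Finset.mem_filter, Finset.mem_piAntidiag, Finset.mem_univ, implies_true, and_true]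
    refine ⟨?_, Fin.cases ?_ fun i => ?_⟩
    · rw [Fin.sum_univ_succ, Fin.cons_zero]
      simp only [Fin.cons_succ]
      exact Nat.sub_add_cancel (hle k)
    · rw [Fin.cons_zero, add_mul]
      omega
    · exact Fin.is_le _
  · intro k _ k' _ h
    exact funext fun i => Fin.ext (congrFun (Fin.cons_injective2 h).2 i)
  · intro K hK
    simp only [Finset.mem_filter, Finset.mem_piAntidiag, Finset.mem_univ, implies_true,
      and_true, Fin.sum_univ_succ (n := m + 1)] at hK
    obtain ⟨hsum, hKd⟩ := hK
    have h0 := hKd 0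
    rw [add_mul] at hsum
    refine ⟨fun i => ⟨K i.succ, Nat.lt_succ_of_le (hKd _)⟩, ?_, ?_⟩
    · refine Finset.mem_filter.2 ⟨Finset.mem_univ _, fun j => ?_⟩
      refine mul_le_sum_filter_ge d (fun i => K i.succ) (fun i => hKd _) ?_ j
      rw [Nat.add_sub_cancel]
      omega
    · refine funext (Fin.cases ?_ fun i => rfl)
      rw [Fin.cons_zero, add_mul]
      dsimp only
      omega

theorem ballMixedTerm_cons {m d : ℕ} (r : Fin (m + 2) → ℝ) (k : Fin (m + 1) → Fin (d + 1)) :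
    ballMixedTerm d r (Fin.cons ((m + 1) * d - ∑ i, (k i : ℕ)) fun i => (k i : ℕ))
      = r 0 ^ ((m + 1) * d - ∑ i, (k i : ℕ)) *
          (∏ i, r i.succ ^ (k i : ℕ) * omegaBall (k i)) *
          (omegaBall d * omegaBall ((m + 1) * d - ∑ i, (k i : ℕ)) /
            (omegaBall ((∑ i, (k i : ℕ)) - m * d) * ∏ i, omegaBall (d - (k i : ℕ)))) *
          ((d.factorial : ℝ) /
            (((((∑ i, (k i : ℕ)) - m * d).factorial : ℝ)) *
              ∏ i, ((d - (k i : ℕ)).factorial : ℝ))) := by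
  have hle : ∑ i, (k i : ℕ) ≤ (m + 1) * d := by
    refine (Finset.sum_le_card_nsmul _ _ d fun i _ => Fin.is_le _).trans (le_of_eq ?_)
    simp
  have hcodeg : d - ((m + 1) * d - ∑ i, (k i : ℕ)) = ∑ i, (k i : ℕ) - m * d := by
    rw [add_mul] at hle ⊢
    omega
  rw [ballMixedTerm, Fin.prod_univ_succ (n := m + 1), Fin.prod_univ_succ (n := m + 1)]
  simp only [Fin.cons_zero, Fin.cons_succ, hcodeg, Finset.prod_mul_distrib]
  ring

end Assembly

theorem volume_inter_nonempty_balls (d n : ℕ) (hd : 1 ≤ d) (hn : 2 ≤ n)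
    (t₁ : EuclideanSpace ℝ (Fin d)) (r : Fin n → ℝ) (hr : ∀ i, 0 < r i) :
    volume {T : Fin (n - 1) → EuclideanSpace ℝ (Fin d) |
        closedBall t₁ (r ⟨0, by omega⟩) ∩
          (⋂ i : Fin (n - 1), closedBall (T i) (r ⟨i.val + 1, by omega⟩)) ≠ ∅}
      = ENNReal.ofReal
          (∑ k ∈ Finset.univ.filter
              (fun k : Fin (n - 1) → Fin (d + 1) =>
                ∀ j : Fin (n - 1),
                  (n - (j.val + 2)) * d ≤ ∑ i ∈ Finset.univ.filter (fun i => j ≤ i), (k i : ℕ)),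
            r ⟨0, by omega⟩ ^ ((n - 1) * d - ∑ i, (k i : ℕ)) *
              (∏ i : Fin (n - 1), r ⟨i.val + 1, by omega⟩ ^ (k i : ℕ) * omegaBall (k i)) *
              (omegaBall d * omegaBall ((n - 1) * d - ∑ i, (k i : ℕ)) /
                (omegaBall ((∑ i, (k i : ℕ)) - (n - 2) * d) *
                  ∏ i : Fin (n - 1), omegaBall (d - (k i : ℕ)))) *
              ((d.factorial : ℝ) /
                (((((∑ i, (k i : ℕ)) - (n - 2) * d).factorial : ℝ)) *
                  ∏ i : Fin (n - 1), ((d - (k i : ℕ)).factorial : ℝ)))) := by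
  obtain ⟨m, rfl⟩ : ∃ m, n = m + 2 := ⟨n - 2, by omega⟩
  refine (volume_setOf_inter_closedBall_ne_empty (m := m + 1) hd t₁ hr).trans ?_
  refine congrArg ENNReal.ofReal ((sum_ballMixedTerm_eq d r).trans
    (Finset.sum_congr (Finset.filter_congr fun k _ => ?_) fun k _ => ballMixedTerm_cons r k))
  simp only [Nat.add_sub_add_right]
  rfl
end

section
/- Let n ≥ 2 be an integer, let t₁ ∈ ℝ be a fixed point, and let r₁, …, rₙ > 0. Then the (n−1)-dimensional Lebesgue measure of the set {(t₂, …, tₙ) ∈ ℝ^{n−1} : ⋂_{i=1}^{n} [tᵢ − rᵢ, tᵢ + rᵢ] ≠ ∅} is equal to 2^{n−1} Σ_{i=1}^{n} ∏_{j≠i} rⱼ. -/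
open MeasureTheory

/-- The set of centres `T` for which the intervals `[T i - r i, T i + r i]` have a common point
in `[a, b]`. -/
def commonPointCentres {m : ℕ} (r : Fin m → ℝ) (a b : ℝ) : Set (Fin m → ℝ) :=
  {T | ∃ x ∈ Set.Icc a b, ∀ i, x ∈ Set.Icc (T i - r i) (T i + r i)}

lemma isCompact_commonPointCentres {m : ℕ} (r : Fin m → ℝ) (a b : ℝ) :
    IsCompact (commonPointCentres r a b) := by
  have h : commonPointCentres r a b =
      (fun p : ℝ × (Fin m → ℝ) => fun i => p.1 + p.2 i) ''
        (Set.Icc a b ×ˢ Set.Icc (fun i => -r i) r) := by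
    ext T
    constructor
    · rintro ⟨x, hx, h⟩
      refine ⟨(x, fun i => T i - x), ⟨hx, fun i => ?_, fun i => ?_⟩, by ext; simp⟩
      · have := (h i).2
        dsimp only
        linarith
      · have := (h i).1
        dsimp only
        linarith
    · rintro ⟨⟨x, v⟩, ⟨hx, h₁, h₂⟩, rfl⟩
      refine ⟨x, hx, fun i => ⟨?_, ?_⟩⟩
      · have := h₂ i
        dsimp only at *
        linarith
      · have := h₁ i
        dsimp only at *
        linarith
  rw [h]
  exact (isCompact_Icc.prod isCompact_Icc).image (by fun_prop)

lemma cons_mem_commonPointCentres {m : ℕ} (r : Fin (m + 1) → ℝ) (a b t : ℝ) (T : Fin m → ℝ) :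
    (Fin.cons t T : Fin (m + 1) → ℝ) ∈ commonPointCentres r a b ↔
      T ∈ commonPointCentres (fun i => r i.succ) (max a (t - r 0)) (min b (t + r 0)) := by
  simp only [commonPointCentres, Set.mem_ofPred_eq, Fin.forall_fin_succ, Fin.cons_zero,
    Fin.cons_succ, ← Set.Icc_inter_Icc, Set.mem_inter_iff, and_assoc]

/-- The length of `[a, b] ∩ [t - ρ, t + ρ]`, integrated over `t`. -/
lemma lintegral_length_inter {a b ρ : ℝ} :
    ∫⁻ t : ℝ, ENNReal.ofReal (min b (t + ρ) - max a (t - ρ)) =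
      ENNReal.ofReal (b - a) * ENNReal.ofReal (2 * ρ) := by
  let s : Set (ℝ × ℝ) := {p | p.2 ∈ Set.Icc a b ∧ p.2 ∈ Set.Icc (p.1 - ρ) (p.1 + ρ)}
  have hs : MeasurableSet s := by
    have h₁ : IsClosed {p : ℝ × ℝ | p.2 ∈ Set.Icc a b} := isClosed_Icc.preimage continuous_snd
    have h₂ : IsClosed {p : ℝ × ℝ | p.1 - ρ ≤ p.2} := isClosed_le (by fun_prop) (by fun_prop)
    have h₃ : IsClosed {p : ℝ × ℝ | p.2 ≤ p.1 + ρ} := isClosed_le (by fun_prop) (by fun_prop)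
    exact (h₁.inter (h₂.inter h₃)).measurableSet
  have h₁ := Measure.prod_apply (μ := (volume : Measure ℝ)) (ν := (volume : Measure ℝ)) hs
  have h₂ := Measure.prod_apply_symm (μ := (volume : Measure ℝ)) (ν := (volume : Measure ℝ)) hs
  have e₁ : ∀ t : ℝ, volume (Prod.mk t ⁻¹' s) =
      ENNReal.ofReal (min b (t + ρ) - max a (t - ρ)) := by
    intro t
    have : Prod.mk t ⁻¹' s = Set.Icc a b ∩ Set.Icc (t - ρ) (t + ρ) := rfl
    rw [this, Set.Icc_inter_Icc, Real.volume_Icc]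
  have e₂ : ∀ x : ℝ, volume ((fun t => (t, x)) ⁻¹' s) =
      (Set.Icc a b).indicator (fun _ => ENNReal.ofReal (2 * ρ)) x := by
    intro x
    by_cases hx : x ∈ Set.Icc a b
    · have : (fun t => (t, x)) ⁻¹' s = Set.Icc (x - ρ) (x + ρ) := by
        ext t
        constructor
        · rintro ⟨-, h₁, h₂⟩
          dsimp only at h₁ h₂
          constructor <;> linarith
        · rintro ⟨h₁, h₂⟩
          refine ⟨hx, ?_, ?_⟩ <;> dsimp only <;> linarith
      rw [this, Real.volume_Icc, Set.indicator_of_mem hx]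
      ring_nf
    · have : (fun t => (t, x)) ⁻¹' s = ∅ := by
        ext t
        simp [s, -Set.mem_Icc, hx]
      rw [this, measure_empty, Set.indicator_of_notMem hx]
  simp_rw [e₁] at h₁
  simp_rw [e₂] at h₂
  rw [← h₁, h₂, lintegral_indicator_const measurableSet_Icc, Real.volume_Icc, mul_comm]

theorem volume_commonPointCentres {m : ℕ} (r : Fin m → ℝ) (hr : ∀ i, 0 ≤ r i) {a b : ℝ}
    (hab : a ≤ b) :
    volume (commonPointCentres r a b) = ∏ i, ENNReal.ofReal (2 * r i) +
      ENNReal.ofReal (b - a) * ∑ i, ∏ j, if j = i then 1 else ENNReal.ofReal (2 * r j) := by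
  induction m generalizing a b with
  | zero =>
    have : commonPointCentres r a b = Set.univ :=
      Set.eq_univ_of_forall fun T => ⟨a, ⟨le_rfl, hab⟩, fun i => i.elim0⟩
    simp [this, volume_pi, Measure.pi_of_empty _ isEmptyElim]
  | succ m ih =>
    have hm := (isCompact_commonPointCentres r a b).measurableSet
    have hp := (volume_preserving_piFinSuccAbove (fun _ : Fin (m + 1) => ℝ) 0).symm
    rw [← hp.measure_preimage hm.nullMeasurableSet, Measure.volume_eq_prod,
      Measure.prod_apply ((MeasurableEquiv.measurable _) hm)]
    set P := ∏ i : Fin m, ENNReal.ofReal (2 * r i.succ) with hP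
    set S := ∑ i : Fin m, ∏ j : Fin m, if j = i then 1 else ENNReal.ofReal (2 * r j.succ) with hS
    have key : ∀ t : ℝ, volume (Prod.mk t ⁻¹'
        ((MeasurableEquiv.piFinSuccAbove (fun _ : Fin (m + 1) => ℝ) 0).symm ⁻¹'
          commonPointCentres r a b)) =
        (Set.Icc (a - r 0) (b + r 0)).indicator (fun _ => P) t +
          ENNReal.ofReal (min b (t + r 0) - max a (t - r 0)) * S := by
      intro t
      have h0 := hr 0
      have : Prod.mk t ⁻¹' ((MeasurableEquiv.piFinSuccAbove (fun _ : Fin (m + 1) => ℝ) 0).symm ⁻¹'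
          commonPointCentres r a b) =
          commonPointCentres (fun i => r i.succ) (max a (t - r 0)) (min b (t + r 0)) := by
        ext T
        rw [← cons_mem_commonPointCentres, Set.mem_preimage, Set.mem_preimage]
        simp [MeasurableEquiv.piFinSuccAbove, Fin.insertNthEquiv]
      rw [this]
      by_cases ht : t ∈ Set.Icc (a - r 0) (b + r 0)
      · rw [Set.indicator_of_mem ht, ih _ fun i => hr _]
        obtain ⟨h₁, h₂⟩ := ht
        apply max_le <;> apply le_min <;> linarith
      · have hlt : min b (t + r 0) < max a (t - r 0) := by
          rw [Set.mem_Icc, not_and_or, not_le, not_le] at ht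
          rcases ht with ht | ht
          · exact (min_le_right _ _).trans_lt ((by linarith : t + r 0 < a).trans_le (le_max_left _ _))
          · exact (min_le_left _ _).trans_lt ((by linarith : b < t - r 0).trans_le (le_max_right _ _))
        have he : commonPointCentres (fun i => r i.succ) (max a (t - r 0)) (min b (t + r 0)) = ∅ := by
          simp [commonPointCentres, Set.Icc_eq_empty_of_lt hlt, -Set.mem_Icc]
        rw [he, measure_empty, Set.indicator_of_notMem ht,
          ENNReal.ofReal_of_nonpos (by linarith), zero_mul, zero_add]
    simp_rw [key]
    rw [lintegral_add_left (measurable_const.indicator measurableSet_Icc),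
      lintegral_indicator_const measurableSet_Icc, lintegral_mul_const _ (by fun_prop),
      lintegral_length_inter, Real.volume_Icc,
      show b + r 0 - (a - r 0) = (b - a) + 2 * r 0 by ring,
      ENNReal.ofReal_add (by linarith) (by linarith [hr 0])]
    simp only [Fin.sum_univ_succ, Fin.prod_univ_succ, Fin.succ_ne_zero, Fin.succ_inj,
      (Fin.succ_ne_zero _).symm, if_true, if_false, one_mul, ← Finset.mul_sum, ← hP, ← hS]
    ring

theorem volume_inter_nonempty_intervals (n : ℕ) (hn : 2 ≤ n)
    (t₁ : ℝ) (r : Fin n → ℝ) (hr : ∀ i, 0 < r i) :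
    volume {T : Fin (n - 1) → ℝ |
        Set.Icc (t₁ - r ⟨0, by omega⟩) (t₁ + r ⟨0, by omega⟩) ∩
          (⋂ i : Fin (n - 1),
            Set.Icc (T i - r ⟨i.val + 1, by omega⟩) (T i + r ⟨i.val + 1, by omega⟩)) ≠ ∅}
      = ENNReal.ofReal
          ((2 : ℝ) ^ (n - 1) *
            ∑ i : Fin n, ∏ j ∈ Finset.univ \ {i}, r j) := by
  obtain ⟨m, rfl⟩ : ∃ m, n = m + 1 := ⟨n - 1, by omega⟩
  have hset : {T : Fin (m + 1 - 1) → ℝ |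
        Set.Icc (t₁ - r ⟨0, by omega⟩) (t₁ + r ⟨0, by omega⟩) ∩
          (⋂ i : Fin (m + 1 - 1),
            Set.Icc (T i - r ⟨i.val + 1, by omega⟩) (T i + r ⟨i.val + 1, by omega⟩)) ≠ ∅} =
      commonPointCentres (fun i : Fin m => r i.succ) (t₁ - r 0) (t₁ + r 0) := by
    ext T
    rw [Set.mem_ofPred_eq, ← Set.nonempty_iff_ne_empty]
    simp only [Set.Nonempty, Set.mem_inter_iff, Set.mem_iInter]
    rfl
  have h0 := hr 0
  have hprod : ∀ i : Fin (m + 1), ∏ j ∈ Finset.univ \ {i}, r j = ∏ j, if j = i then 1 else r j := by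
    intro i
    rw [Finset.prod_ite, Finset.prod_const_one, one_mul]
    congr 1
    ext j
    simp
  have hreal : (2 : ℝ) ^ (m + 1 - 1) * ∑ i : Fin (m + 1), ∏ j ∈ Finset.univ \ {i}, r j =
      ∏ i : Fin m, (2 * r i.succ) +
        (t₁ + r 0 - (t₁ - r 0)) * ∑ i : Fin m, ∏ j : Fin m, if j = i then 1 else 2 * r j.succ := by
    have hscale : ∀ i : Fin m, 2 * ∏ j : Fin m, (if j = i then 1 else 2 * r j.succ) =
        2 ^ m * ∏ j : Fin m, if j = i then 1 else r j.succ := by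
      intro i
      have h2 : (2 : ℝ) = ∏ j : Fin m, if j = i then 2 else 1 := by simp
      have hm : (2 : ℝ) ^ m = ∏ _j : Fin m, 2 := by simp
      rw [hm, ← Finset.prod_mul_distrib]
      refine (congrArg (· * _) h2).trans ?_
      rw [← Finset.prod_mul_distrib]
      refine Finset.prod_congr rfl fun j _ => ?_
      split_ifs <;> ring
    simp_rw [hprod]
    simp only [Fin.sum_univ_succ, Fin.prod_univ_succ, Fin.succ_ne_zero, Fin.succ_inj,
      (Fin.succ_ne_zero _).symm, if_true, if_false, one_mul, ← Finset.mul_sum,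
      Finset.prod_mul_distrib, Finset.prod_const, Finset.card_univ, Fintype.card_fin,
      Nat.add_sub_cancel]
    rw [show t₁ + r 0 - (t₁ - r 0) = r 0 * 2 by ring, mul_assoc (r 0), Finset.mul_sum _ _ (2 : ℝ)]
    simp_rw [hscale, ← Finset.mul_sum]
    ring
  have hpos : ∀ i : Fin m, 0 ≤ 2 * r i.succ := fun i => by linarith [hr i.succ]
  have hite : ∀ i j : Fin m, 0 ≤ if j = i then 1 else 2 * r j.succ := fun i j => by
    split_ifs
    exacts [zero_le_one, hpos j]
  have hsum : ∀ i : Fin m, 0 ≤ ∏ j : Fin m, if j = i then 1 else 2 * r j.succ :=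
    fun i => Finset.prod_nonneg fun j _ => hite i j
  have hlen : 0 ≤ t₁ + r 0 - (t₁ - r 0) := by linarith
  rw [hset, hreal, ENNReal.ofReal_add (Finset.prod_nonneg fun i _ => hpos i)
    (mul_nonneg hlen (Finset.sum_nonneg fun i _ => hsum i)), ENNReal.ofReal_mul hlen,
    ENNReal.ofReal_prod_of_nonneg fun i _ => hpos i,
    ENNReal.ofReal_sum_of_nonneg fun i _ => hsum i]
  simp_rw [fun i : Fin m => ENNReal.ofReal_prod_of_nonneg fun j (_ : j ∈ Finset.univ) => hite i j,
    apply_ite ENNReal.ofReal, ENNReal.ofReal_one]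
  exact volume_commonPointCentres _ (fun i => (hr _).le) (by linarith)
end

section
/- Let n ≥ 2 be an integer, let t₁ ∈ ℝ² be a fixed point, and let r₁, …, rₙ > 0. Then the 2(n−1)-dimensional Lebesgue measure of the set {(t₂, …, tₙ) ∈ (ℝ²)^{n−1} : ⋂_{i=1}^{n} B(tᵢ, rᵢ) ≠ ∅} is equal to π^{n−1} Σ_{i=1}^{n} ∏_{j≠i} rⱼ² + 2π^{n−1} Σ_{1≤i<j≤n} rᵢ rⱼ ∏_{k≠i,j} rₖ². -/
open MeasureTheory Metric

namespace DiskIntersection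

/-- The Euclidean plane. -/
abbrev Plane := EuclideanSpace ℝ (Fin 2)

variable {ι : Type*}

/-- The intersection of the closed disks with centers `T i` and radii `r i`. -/
def diskInter (r : ι → ℝ) (T : ι → Plane) : Set Plane := ⋂ i, closedBall (T i) (r i)

/-- `p` is a point of `s` whose second coordinate is minimal among points of `s`. -/
def IsLowest (s : Set Plane) (p : Plane) : Prop := p ∈ s ∧ ∀ q ∈ s, p 1 ≤ q 1

open Classical in
/-- A lowest point of an intersection of disks, with junk value `0` if there is none. -/
noncomputable def lowest (r : ι → ℝ) (T : ι → Plane) : Plane :=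
  if h : ∃ p, IsLowest (diskInter r T) p then h.choose else 0

/-- The configurations of disks with a common point for which `G` is the set of the disks whose
boundary contains the lowest common point. -/
def tight (r : ι → ℝ) (G : Finset ι) : Set (ι → Plane) :=
  {T | (diskInter r T).Nonempty ∧ ∀ i, dist (lowest r T) (T i) = r i ↔ i ∈ G}

lemma mem_diskInter {r : ι → ℝ} {T : ι → Plane} {p : Plane} :
    p ∈ diskInter r T ↔ ∀ i, dist p (T i) ≤ r i := by
  simp [diskInter]

lemma convex_diskInter (r : ι → ℝ) (T : ι → Plane) : Convex ℝ (diskInter r T) :=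
  convex_iInter fun _ => convex_closedBall _ _

lemma isCompact_diskInter [Nonempty ι] (r : ι → ℝ) (T : ι → Plane) :
    IsCompact (diskInter r T) :=
  (isCompact_closedBall (T (Classical.arbitrary ι)) (r (Classical.arbitrary ι))).of_isClosed_subset
    (isClosed_iInter fun _ => isClosed_closedBall) (Set.iInter_subset _ _)

lemma exists_isLowest {s : Set Plane} (hs : IsCompact s) (hne : s.Nonempty) :
    ∃ p, IsLowest s p := by
  obtain ⟨p, hp, h⟩ := hs.exists_isMinOn hne
    (show Continuous fun p : Plane => p 1 by fun_prop).continuousOn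
  exact ⟨p, hp, fun q hq => h hq⟩

lemma IsLowest.restrict [Finite ι] {r : ι → ℝ} {T : ι → Plane} {p : Plane} {G : Finset ι}
    (hp : IsLowest (diskInter r T) p) (hG : ∀ i ∉ G, dist p (T i) < r i) :
    IsLowest (diskInter (fun i : G => r i) (fun i : G => T i)) p := by
  have hpm := mem_diskInter.1 hp.1
  have hpG : p ∈ diskInter (fun i : G => r i) (fun i : G => T i) :=
    mem_diskInter.2 fun i => hpm i
  refine ⟨hpG, fun q hq => ?_⟩
  by_contra! hlt
  have hcont : Continuous fun ε : ℝ => p + ε • (q - p) := by fun_prop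
  have hev : ∀ᶠ ε in nhds (0 : ℝ), ∀ i, i ∉ G → dist (p + ε • (q - p)) (T i) < r i := by
    refine Filter.eventually_all.2 fun i => ?_
    by_cases hi : i ∈ G
    · simp [hi]
    have : Continuous fun ε : ℝ => dist (p + ε • (q - p)) (T i) := by fun_prop
    have h0 := this.tendsto 0
    simp only [zero_smul, add_zero] at h0
    filter_upwards [h0.eventually_lt_const (hG i hi)] with ε hε _ using hε
  obtain ⟨ε, hε, hεpos, hε1⟩ : ∃ ε : ℝ, (∀ i, i ∉ G → dist (p + ε • (q - p)) (T i) < r i) ∧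
      0 < ε ∧ ε < 1 :=
    (((hev.filter_mono nhdsWithin_le_nhds).and
      (Ioo_mem_nhdsGT one_pos)).exists (f := nhdsWithin (0 : ℝ) (Set.Ioi 0)))
  have hmem : p + ε • (q - p) ∈ diskInter (fun i : G => r i) (fun i : G => T i) :=
    (convex_diskInter _ _).add_smul_sub_mem hpG hq ⟨hεpos.le, hε1.le⟩
  have hmem' : p + ε • (q - p) ∈ diskInter r T := by
    refine mem_diskInter.2 fun i => ?_
    by_cases hi : i ∈ G
    · exact mem_diskInter.1 hmem ⟨i, hi⟩
    · exact (hε i hi).le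
  have := hp.2 _ hmem'
  simp only [PiLp.add_apply, PiLp.smul_apply, PiLp.sub_apply, smul_eq_mul] at this
  nlinarith

lemma IsLowest.exists_dist_eq [Finite ι] {r : ι → ℝ} {T : ι → Plane} {p : Plane}
    (hp : IsLowest (diskInter r T) p) : ∃ i, dist p (T i) = r i := by
  by_contra! h
  have := (hp.restrict (G := ∅) fun i _ => lt_of_le_of_ne (mem_diskInter.1 hp.1 i) (h i)).2
    (p - EuclideanSpace.single 1 1) (mem_diskInter.2 fun i => absurd i.2 (Finset.notMem_empty _))
  simp at this
  linarith

lemma IsLowest.unique [Finite ι] {r : ι → ℝ} (hr : ∀ i, 0 < r i) {T : ι → Plane} {p q : Plane}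
    (hp : IsLowest (diskInter r T) p) (hq : IsLowest (diskInter r T) q) : p = q := by
  by_contra hne
  have hint (i : ι) : dist ((2⁻¹ : ℝ) • p + (2⁻¹ : ℝ) • q) (T i) < r i := by
    have := strictConvex_closedBall ℝ (T i) (r i) (mem_diskInter.1 hp.1 i)
      (mem_diskInter.1 hq.1 i) hne (a := 2⁻¹) (b := 2⁻¹) (by norm_num) (by norm_num) (by norm_num)
    rwa [interior_closedBall _ (hr i).ne'] at this
  have hlow : IsLowest (diskInter r T) ((2⁻¹ : ℝ) • p + (2⁻¹ : ℝ) • q) := by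
    refine ⟨mem_diskInter.2 fun i => (hint i).le, fun s hs => ?_⟩
    have h1 := hp.2 s hs
    have h2 := hq.2 s hs
    simp only [PiLp.add_apply, PiLp.smul_apply, smul_eq_mul]
    linarith
  obtain ⟨i, hi⟩ := hlow.exists_dist_eq
  exact (hint i).ne hi

lemma isLowest_lowest [Nonempty ι] {r : ι → ℝ} {T : ι → Plane} (h : (diskInter r T).Nonempty) :
    IsLowest (diskInter r T) (lowest r T) := by
  have hex := exists_isLowest (isCompact_diskInter r T) h
  rw [lowest, dif_pos hex]
  exact hex.choose_spec

lemma IsLowest.lowest_eq [Finite ι] [Nonempty ι] {r : ι → ℝ} (hr : ∀ i, 0 < r i)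
    {T : ι → Plane} {p : Plane} (hp : IsLowest (diskInter r T) p) : lowest r T = p :=
  (isLowest_lowest ⟨p, hp.1⟩).unique hr hp

lemma IsLowest.add_right {r : ι → ℝ} {T : ι → Plane} {p : Plane} (hp : IsLowest (diskInter r T) p)
    (v : Plane) : IsLowest (diskInter r fun i => T i + v) (p + v) := by
  refine ⟨mem_diskInter.2 fun i => by simpa using mem_diskInter.1 hp.1 i, fun q hq => ?_⟩
  have := hp.2 (q - v) (mem_diskInter.2 fun i => by
    have := mem_diskInter.1 hq i
    rwa [dist_eq_norm, show q - v - T i = q - (T i + v) by abel, ← dist_eq_norm])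
  simp only [PiLp.add_apply, PiLp.sub_apply] at this ⊢
  linarith

lemma add_right_mem_tight [Finite ι] [Nonempty ι] {r : ι → ℝ} (hr : ∀ i, 0 < r i) {G : Finset ι}
    {T : ι → Plane} (hT : T ∈ tight r G) (v : Plane) : (fun i => T i + v) ∈ tight r G := by
  have h := (isLowest_lowest hT.1).add_right v
  refine ⟨⟨_, h.1⟩, fun i => ?_⟩
  rw [h.lowest_eq hr, dist_add_right]
  exact hT.2 i

lemma add_right_mem_tight_iff [Finite ι] [Nonempty ι] {r : ι → ℝ} (hr : ∀ i, 0 < r i)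
    (G : Finset ι) (v : Plane) (T : ι → Plane) :
    (fun i => T i + v) ∈ tight r G ↔ T ∈ tight r G :=
  ⟨fun h => by simpa using add_right_mem_tight hr h (-v), fun h => add_right_mem_tight hr h v⟩

/-- By Helly's theorem, the lowest common point of finitely many disks is already the lowest common
point of at most two of them. -/
lemma IsLowest.exists_card_le_two [Finite ι] {r : ι → ℝ} {T : ι → Plane} {p : Plane}
    (hp : IsLowest (diskInter r T) p) :
    ∃ G : Finset ι, G.card ≤ 2 ∧ IsLowest (diskInter (fun i : G => r i) (fun i : G => T i)) p := by
  classical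
  have := Fintype.ofFinite ι
  let F : Option ι → Set Plane := fun o => o.elim {q | q 1 < p 1} fun i => closedBall (T i) (r i)
  have hconv : ∀ o ∈ (Finset.univ : Finset (Option ι)), Convex ℝ (F o) := by
    rintro (_ | i) -
    · exact (convex_Iio (p 1)).is_linear_preimage (f := fun q : Plane => q 1)
        ⟨fun _ _ => rfl, fun _ _ => rfl⟩
    · exact convex_closedBall _ _
  have hempty : ¬ (⋂ o ∈ (Finset.univ : Finset (Option ι)), F o).Nonempty := by
    rintro ⟨q, hq⟩
    simp only [Finset.mem_univ, Set.iInter_true, Set.mem_iInter] at hq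
    exact (hp.2 q (mem_diskInter.2 fun i => hq (some i))).not_gt (hq none)
  obtain ⟨I, -, hIcard, hI⟩ : ∃ I ⊆ (Finset.univ : Finset (Option ι)),
      I.card ≤ Module.finrank ℝ Plane + 1 ∧ ¬ (⋂ o ∈ I, F o).Nonempty := by
    by_contra! h
    exact hempty (Convex.helly_theorem' hconv h)
  have hpm := mem_diskInter.1 hp.1
  have hnone : none ∈ I := by
    by_contra hn
    refine hI ⟨p, Set.mem_iInter₂.2 ?_⟩
    rintro (_ | i) hi
    · exact absurd hi hn
    · exact hpm i
  refine ⟨Finset.eraseNone I, ?_, mem_diskInter.2 fun i => hpm i, fun q hq => ?_⟩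
  · have := Finset.card_eraseNone_of_mem hnone
    simp only [finrank_euclideanSpace, Fintype.card_fin] at hIcard
    omega
  · by_contra! hlt
    refine hI ⟨q, Set.mem_iInter₂.2 ?_⟩
    rintro (_ | i) hi
    · exact hlt
    · exact mem_diskInter.1 hq ⟨i, Finset.mem_eraseNone.2 hi⟩

lemma isClosed_setOf_exists_mem_diskInter [Nonempty ι] (r : ι → ℝ) {F : Set Plane}
    (hF : IsClosed F) :
    IsClosed {T : ι → Plane | ∃ p ∈ diskInter r T, p ∈ F} := by
  let i₀ := Classical.arbitrary ι
  have hclosed : IsClosed {x : (ι → Plane) × closedBall (0 : Plane) (r i₀) |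
      (∀ i, dist (x.1 i₀ + x.2) (x.1 i) ≤ r i) ∧ x.1 i₀ + (x.2 : Plane) ∈ F} := by
    simp only [Set.ofPred_and, Set.ofPred_forall]
    exact .inter (isClosed_iInter fun i => isClosed_le (by fun_prop) (by fun_prop))
      (hF.preimage (by fun_prop))
  convert isClosedMap_fst_of_compactSpace _ hclosed using 1
  ext T
  constructor
  · rintro ⟨p, hp, hpF⟩
    rw [mem_diskInter] at hp
    refine ⟨(T, ⟨p - T i₀, ?_⟩), ⟨fun i => ?_, ?_⟩, rfl⟩
    · simpa [dist_eq_norm] using hp i₀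
    · simpa using hp i
    · simpa using hpF
  · rintro ⟨⟨T', u⟩, ⟨h1, h2⟩, rfl⟩
    exact ⟨T' i₀ + u, mem_diskInter.2 h1, h2⟩

lemma measurableSet_nonempty_diskInter [Finite ι] [Nonempty ι] (r : ι → ℝ) :
    MeasurableSet {T : ι → Plane | (diskInter r T).Nonempty} := by
  simpa [Set.Nonempty] using (isClosed_setOf_exists_mem_diskInter r isClosed_univ).measurableSet

lemma lowest_mem_iff [Finite ι] [Nonempty ι] {r : ι → ℝ} (hr : ∀ i, 0 < r i) {T : ι → Plane}
    (hT : (diskInter r T).Nonempty) {F : Set Plane} (hF : IsClosed F) :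
    lowest r T ∈ F ↔ ∀ c : ℚ, (∃ p ∈ diskInter r T, p ∈ {p : Plane | p 1 ≤ c}) →
      ∃ p ∈ diskInter r T, p ∈ F ∩ {p : Plane | p 1 ≤ c} := by
  have hlow := isLowest_lowest hT
  constructor
  · rintro h c ⟨p, hp, hpc⟩
    exact ⟨_, hlow.1, h, (hlow.2 p hp).trans hpc⟩
  · intro h
    have key (c : ℚ) (hc : lowest r T 1 < c) :
        ∃ p ∈ diskInter r T, p ∈ F ∩ {p : Plane | p 1 ≤ c} :=
      h c ⟨_, hlow.1, hc.le⟩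
    obtain ⟨c₀, hc₀⟩ := exists_rat_gt (lowest r T 1)
    obtain ⟨p₀, hp₀, hp₀F, -⟩ := key c₀ hc₀
    obtain ⟨p, ⟨hp, hpF⟩, hmin⟩ :=
      exists_isLowest ((isCompact_diskInter r T).inter_right hF) ⟨p₀, hp₀, hp₀F⟩
    have hle : p 1 ≤ lowest r T 1 := by
      refine le_of_forall_lt_rat_imp_le fun c hc => ?_
      obtain ⟨q, hq, hqF, hqc⟩ := key c hc
      exact (hmin q ⟨hq, hqF⟩).trans hqc
    have : IsLowest (diskInter r T) p := ⟨hp, fun q hq => hle.trans (hlow.2 q hq)⟩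
    rwa [this.lowest_eq hr]

lemma measurable_lowest [Finite ι] [Nonempty ι] {r : ι → ℝ} (hr : ∀ i, 0 < r i) :
    Measurable (lowest r) := by
  refine measurable_of_isClosed fun F hF => ?_
  have hset : lowest r ⁻¹' F = ({T | (diskInter r T).Nonempty} ∩ ⋂ c : ℚ,
      ({T | ∃ p ∈ diskInter r T, p ∈ {p : Plane | p 1 ≤ c}}ᶜ ∪
        {T | ∃ p ∈ diskInter r T, p ∈ F ∩ {p : Plane | p 1 ≤ c}})) ∪
      ({T | (diskInter r T).Nonempty}ᶜ ∩ {_T | (0 : Plane) ∈ F}) := by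
    ext T
    by_cases hT : (diskInter r T).Nonempty
    · simp only [Set.mem_preimage, lowest_mem_iff hr hT hF, Set.mem_union, Set.mem_inter_iff,
        Set.mem_iInter, Set.mem_compl_iff, Set.mem_ofPred_eq, hT, true_and, not_true, false_and,
        or_false, imp_iff_not_or]
    · have : lowest r T = 0 := dif_neg fun ⟨p, hp⟩ => hT ⟨p, hp.1⟩
      simp [hT, this]
  have hhalf (c : ℚ) : IsClosed {p : Plane | p 1 ≤ c} :=
    isClosed_le (by fun_prop) continuous_const
  rw [hset]
  have hne := measurableSet_nonempty_diskInter r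
  refine .union (hne.inter (.iInter fun c => .union ?_ ?_)) (hne.compl.inter (.const _))
  · exact (isClosed_setOf_exists_mem_diskInter r (hhalf c)).measurableSet.compl
  · exact (isClosed_setOf_exists_mem_diskInter r (hF.inter (hhalf c))).measurableSet

lemma measurableSet_tight [Finite ι] [Nonempty ι] {r : ι → ℝ} (hr : ∀ i, 0 < r i)
    (G : Finset ι) : MeasurableSet (tight r G) := by
  simp only [tight, Set.ofPred_and, Set.ofPred_forall]
  refine (measurableSet_nonempty_diskInter r).inter (.iInter fun i => ?_)
  have := measurable_lowest hr
  exact (measurableSet_eq_fun (by fun_prop) measurable_const).iff (.const _)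

lemma tight_empty [Finite ι] [Nonempty ι] (r : ι → ℝ) : tight r ∅ = ∅ := by
  refine Set.eq_empty_of_forall_notMem fun T hT => ?_
  obtain ⟨i, hi⟩ := (isLowest_lowest hT.1).exists_dist_eq
  exact Finset.notMem_empty i ((hT.2 i).1 hi)

lemma mem_tight_iff [Finite ι] {r : ι → ℝ} (hr : ∀ i, 0 < r i) {G : Finset ι}
    (hG : G.Nonempty) {T : ι → Plane} :
    T ∈ tight r G ↔
      (fun i : G => T i) ∈ tight (fun i : G => r i) Finset.univ ∧
        ∀ k ∉ G, T k - lowest (fun i : G => r i) (fun i : G => T i) ∈ ball 0 (r k) := by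
  have := hG.to_subtype
  have : Nonempty ι := ⟨hG.choose⟩
  have hrG : ∀ i : G, 0 < r i := fun i => hr i
  simp only [mem_ball_zero_iff, ← dist_eq_norm]
  constructor
  · intro hT
    have hlow := isLowest_lowest hT.1
    have hlt : ∀ i ∉ G, dist (lowest r T) (T i) < r i := fun i hi =>
      lt_of_le_of_ne (mem_diskInter.1 hlow.1 i) fun h => hi ((hT.2 i).1 h)
    have hres := hlow.restrict hlt
    have heq := hres.lowest_eq hrG
    refine ⟨⟨⟨_, hres.1⟩, fun i => ?_⟩, fun k hk => ?_⟩
    · simpa [heq] using (hT.2 i).2 i.2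
    · rw [heq, dist_comm]
      exact hlt k hk
  · rintro ⟨hT, hlt⟩
    have hlow := isLowest_lowest hT.1
    have hmem : lowest (fun i : G => r i) (fun i : G => T i) ∈ diskInter r T := by
      refine mem_diskInter.2 fun i => ?_
      by_cases hi : i ∈ G
      · exact mem_diskInter.1 hlow.1 ⟨i, hi⟩
      · rw [dist_comm]
        exact (hlt i hi).le
    have hlow' : IsLowest (diskInter r T) (lowest (fun i : G => r i) (fun i : G => T i)) :=
      ⟨hmem, fun q hq => hlow.2 q (mem_diskInter.2 fun i => mem_diskInter.1 hq i)⟩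
    refine ⟨⟨_, hmem⟩, fun i => ?_⟩
    rw [hlow'.lowest_eq hr]
    refine ⟨fun h => ?_, fun hi => (hT.2 ⟨i, hi⟩).2 (Finset.mem_univ _)⟩
    by_contra hi
    exact (hlt i hi).ne (by rw [dist_comm, h])

lemma setOf_nonempty_diskInter [Fintype ι] (r : ι → ℝ) :
    {T : ι → Plane | (diskInter r T).Nonempty} = ⋃ G : Finset ι, tight r G := by
  classical
  ext T
  simp only [Set.mem_ofPred_eq, Set.mem_iUnion]
  exact ⟨fun h => ⟨Finset.univ.filter fun i => dist (lowest r T) (T i) = r i, h, by simp⟩,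
    fun ⟨_, h⟩ => h.1⟩

lemma pairwise_disjoint_tight (r : ι → ℝ) :
    Pairwise fun G H : Finset ι => Disjoint (tight r G) (tight r H) := by
  refine fun G H hne => Set.disjoint_left.2 fun T hG hH => hne (Finset.ext fun i => ?_)
  rw [← hG.2, hH.2]

/-- Fubini's theorem for a set of configurations in which the points outside `G` lie in prescribed
sets translated by a vector depending on the points in `G`. -/
lemma volume_setOf_restrict_mem [Fintype ι] [DecidableEq ι] (G : Finset ι)
    {A : Set (G → Plane)} (hA : MeasurableSet A) {c : (G → Plane) → Plane} (hc : Measurable c)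
    {C : ι → Set Plane} (hC : ∀ k, MeasurableSet (C k)) :
    volume {T : ι → Plane | (fun i : G => T i) ∈ A ∧ ∀ k ∉ G, T k - c (fun i : G => T i) ∈ C k} =
      volume A * ∏ k ∈ Gᶜ, volume (C k) := by
  let e := MeasurableEquiv.piEquivPiSubtypeProd (fun _ : ι => Plane) (· ∈ G)
  let D : Set ((G → Plane) × ({k // k ∉ G} → Plane)) :=
    {x | x.1 ∈ A ∧ ∀ k : {k // k ∉ G}, x.2 k - c x.1 ∈ C k}
  have hD : MeasurableSet D := by
    simp only [D, Set.ofPred_and, Set.ofPred_forall]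
    exact (measurable_fst hA).inter <| .iInter fun k =>
      (by fun_prop : Measurable fun x : (G → Plane) × ({k // k ∉ G} → Plane) =>
        x.2 k - c x.1) (hC k)
  have hpre : {T : ι → Plane | (fun i : G => T i) ∈ A ∧
      ∀ k ∉ G, T k - c (fun i : G => T i) ∈ C k} = e ⁻¹' D := by
    ext T
    simp only [Set.mem_ofPred_eq, Set.mem_preimage, D, Subtype.forall]
    rfl
  have hsec (U : G → Plane) : volume (Prod.mk U ⁻¹' D) =
      A.indicator (fun _ => ∏ k ∈ Gᶜ, volume (C k)) U := by
    by_cases hU : U ∈ A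
    · have : Prod.mk U ⁻¹' D = Set.univ.pi fun k : {k // k ∉ G} => (· - c U) ⁻¹' C k := by
        ext W
        simp [D, hU]
      rw [this, volume_pi_pi, Set.indicator_of_mem hU]
      simp only [sub_eq_add_neg, measure_preimage_add_right]
      exact (Finset.prod_subtype Gᶜ (by simp) fun k => volume (C k)).symm
    · have : Prod.mk U ⁻¹' D = ∅ := by
        ext W
        simp [D, hU]
      rw [this, measure_empty, Set.indicator_of_notMem hU]
  rw [hpre, (volume_preserving_piEquivPiSubtypeProd _ _).measure_preimage_equiv,
    Measure.volume_eq_prod, Measure.prod_apply hD]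
  simp_rw [hsec]
  rw [lintegral_indicator_const hA, mul_comm]
  congr!

/-- For a translation-invariant set of configurations, the volume of the part of it in which the
`i`-th point lies in `Q` does not depend on `i`. -/
lemma volume_inter_eval_preimage_eq [Fintype ι] {S : Set (ι → Plane)} (hS : MeasurableSet S)
    (htr : ∀ (v : Plane) (T : ι → Plane), (fun i => T i + v) ∈ S ↔ T ∈ S) {Q : Set Plane}
    (hQ : MeasurableSet Q) (h0 : volume Q ≠ 0) (htop : volume Q ≠ ⊤) (i j : ι) :
    volume (S ∩ {T | T i ∈ Q}) = volume (S ∩ {T | T j ∈ Q}) := by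
  have hmeas (i : ι) : MeasurableSet (S ∩ {T | T i ∈ Q}) :=
    hS.inter (measurable_pi_apply i hQ)
  let D : Set ((ι → Plane) × Plane) := {x | x.1 ∈ S ∩ {T | T i ∈ Q} ∧ x.1 j - x.2 ∈ Q}
  let D' : Set ((ι → Plane) × Plane) := {x | x.1 ∈ S ∩ {T | T j ∈ Q} ∧ x.2 + x.1 i ∈ Q}
  have hD : MeasurableSet D := (measurable_fst (hmeas i)).inter
    ((by fun_prop : Measurable fun x : (ι → Plane) × Plane => x.1 j - x.2) hQ)
  have hD' : MeasurableSet D' := (measurable_fst (hmeas j)).inter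
    ((by fun_prop : Measurable fun x : (ι → Plane) × Plane => x.2 + x.1 i) hQ)
  have hvD : (volume.prod volume) D = volume Q * volume (S ∩ {T | T i ∈ Q}) := by
    rw [Measure.prod_apply hD, ← lintegral_indicator_const (hmeas i)]
    refine lintegral_congr fun T => ?_
    by_cases hT : T ∈ S ∩ {T | T i ∈ Q}
    · rw [Set.indicator_of_mem hT,
        ← (Measure.measurePreserving_sub_left volume (T j)).measure_preimage hQ.nullMeasurableSet]
      congr 1
      ext x
      exact and_iff_right hT
    · rw [Set.indicator_of_notMem hT]
      exact (congrArg _ (Set.eq_empty_of_forall_notMem fun x hx => hT hx.1)).trans measure_empty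
  have hvD' : (volume.prod volume) D' = volume Q * volume (S ∩ {T | T j ∈ Q}) := by
    rw [Measure.prod_apply hD', ← lintegral_indicator_const (hmeas j)]
    refine lintegral_congr fun T => ?_
    by_cases hT : T ∈ S ∩ {T | T j ∈ Q}
    · rw [Set.indicator_of_mem hT, ← measure_preimage_add_right volume (T i) Q]
      congr 1
      ext x
      exact and_iff_right hT
    · rw [Set.indicator_of_notMem hT]
      exact (congrArg _ (Set.eq_empty_of_forall_notMem fun x hx => hT hx.1)).trans measure_empty
  have hDD' : (volume.prod volume) D = (volume.prod volume) D' := by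
    rw [Measure.prod_apply_symm hD, Measure.prod_apply_symm hD']
    refine lintegral_congr fun x => ?_
    rw [← measure_preimage_add_right volume (fun _ : ι => x)]
    congr 1
    ext T
    have := htr x T
    simp only [D, D', Set.mem_preimage, Set.mem_ofPred_eq, Set.mem_inter_iff, Pi.add_apply,
      add_sub_cancel_right, add_comm x]
    rw [show T + (fun _ => x) = fun i => T i + x from rfl, this]
    tauto
  rwa [hvD, hvD', ENNReal.mul_right_inj h0 htop] at hDD'

lemma volume_setOf_apply_mem_of_subsingleton [Fintype ι] [Subsingleton ι] (i : ι) (Q : Set Plane) :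
    volume {T : ι → Plane | T i ∈ Q} = volume Q := by
  have : {T : ι → Plane | T i ∈ Q} = Set.univ.pi fun _ => Q := by
    ext T
    exact ⟨fun h j _ => Subsingleton.elim i j ▸ h, fun h => h i trivial⟩
  rw [this, volume_pi_pi]
  have := uniqueOfSubsingleton i
  simp

lemma tight_univ_of_subsingleton [Fintype ι] [Subsingleton ι] {r : ι → ℝ} (hr : ∀ i, 0 < r i)
    (i : ι) : tight r Finset.univ = Set.univ := by
  have : Nonempty ι := ⟨i⟩
  refine Set.eq_univ_of_forall fun T => ?_
  have hne : (diskInter r T).Nonempty :=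
    ⟨T i, mem_diskInter.2 fun j => by simpa [Subsingleton.elim j i] using (hr i).le⟩
  obtain ⟨j, hj⟩ := (isLowest_lowest hne).exists_dist_eq
  exact ⟨hne, fun k => by simpa [Subsingleton.elim k j] using hj⟩

lemma volume_tight_univ_eq_zero [Fintype ι] {r : ι → ℝ} (hr : ∀ i, 0 < r i)
    (hcard : 2 < Fintype.card ι) : volume (tight r Finset.univ) = 0 := by
  classical
  have : Nonempty ι := Fintype.card_pos_iff.1 (by omega)
  let N (G : Finset ι) : Set (ι → Plane) := {T | (fun i : G => T i) ∈ Set.univ ∧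
    ∀ k ∉ G, T k - lowest (fun i : G => r i) (fun i : G => T i) ∈ sphere 0 (r k)}
  have hsub : tight r Finset.univ ⊆ ⋃ G ∈ {G : Finset ι | G.Nonempty ∧ G.card ≤ 2}, N G := by
    intro T hT
    obtain ⟨G, hG, hlow⟩ := (isLowest_lowest hT.1).exists_card_le_two
    obtain ⟨i, -⟩ := hlow.exists_dist_eq
    have : Nonempty G := ⟨i⟩
    refine Set.mem_biUnion (show G ∈ _ from ⟨⟨i, i.2⟩, hG⟩) ⟨trivial, fun k _ => ?_⟩
    rw [hlow.lowest_eq (r := fun i : G => r i) fun i => hr i, mem_sphere_zero_iff_norm,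
      ← dist_eq_norm, dist_comm]
    exact (hT.2 k).2 (Finset.mem_univ k)
  refine measure_mono_null hsub ((measure_biUnion_null_iff (Set.to_countable _)).2 ?_)
  rintro G ⟨hne, hG⟩
  have := hne.to_subtype
  obtain ⟨k, hk⟩ : ∃ k, k ∉ G := by
    by_contra! h
    rw [Finset.eq_univ_of_forall h, Finset.card_univ] at hG
    omega
  rw [volume_setOf_restrict_mem G .univ (measurable_lowest fun i => hr i)
    fun k => isClosed_sphere.measurableSet,
    Finset.prod_eq_zero (Finset.mem_compl.2 hk) (Measure.addHaar_sphere _ _ _), mul_zero]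

lemma volume_tight_inter [Fintype ι] [DecidableEq ι] {r : ι → ℝ} (hr : ∀ i, 0 < r i)
    {G : Finset ι} {i : ι} (hi : i ∈ G) {Q : Set Plane} (hQ : MeasurableSet Q) :
    volume (tight r G ∩ {T | T i ∈ Q}) =
      volume (tight (fun i : G => r i) Finset.univ ∩ {U | U ⟨i, hi⟩ ∈ Q}) *
        ∏ k ∈ Gᶜ, volume (ball (0 : Plane) (r k)) := by
  have : Nonempty G := ⟨i, hi⟩
  have hrG : ∀ i : G, 0 < r i := fun i => hr i
  have hA : MeasurableSet (tight (fun i : G => r i) Finset.univ ∩ {U | U ⟨i, hi⟩ ∈ Q}) :=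
    (measurableSet_tight hrG _).inter (measurable_pi_apply (⟨i, hi⟩ : G) hQ)
  rw [← volume_setOf_restrict_mem G hA (measurable_lowest hrG) fun k => measurableSet_ball]
  congr 1
  ext T
  simp only [Set.mem_inter_iff, mem_tight_iff hr ⟨i, hi⟩, Set.mem_ofPred_eq]
  tauto

lemma volume_nonempty_inter [Fintype ι] [Nonempty ι] {r : ι → ℝ} (hr : ∀ i, 0 < r i) (i : ι)
    {Q : Set Plane} (hQ : MeasurableSet Q) :
    volume ({T | (diskInter r T).Nonempty} ∩ {T | T i ∈ Q}) =
      ∑ G : Finset ι, volume (tight r G ∩ {T | T i ∈ Q}) := by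
  rw [setOf_nonempty_diskInter, Set.iUnion_inter, measure_iUnion, tsum_fintype]
  · exact fun G H h => (pairwise_disjoint_tight r h).mono Set.inter_subset_left Set.inter_subset_left
  · exact fun G => (measurableSet_tight hr G).inter (measurable_pi_apply i hQ)

lemma volume_tight_singleton_inter [Fintype ι] [DecidableEq ι] {r : ι → ℝ} (hr : ∀ i, 0 < r i)
    {Q : Set Plane} (hQ : MeasurableSet Q) (h0 : volume Q ≠ 0) (htop : volume Q ≠ ⊤) (i j : ι) :
    volume (tight r {i} ∩ {T | T j ∈ Q}) =
      volume Q * ∏ k ∈ {i}ᶜ, volume (ball (0 : Plane) (r k)) := by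
  have : Nonempty ι := ⟨i⟩
  rw [volume_inter_eval_preimage_eq (measurableSet_tight hr _) (add_right_mem_tight_iff hr _)
    hQ h0 htop j i, volume_tight_inter hr (Finset.mem_singleton_self i) hQ,
    tight_univ_of_subsingleton (r := fun k : ({i} : Finset ι) => r k) (fun k => hr k)
      ⟨i, Finset.mem_singleton_self i⟩, Set.univ_inter,
    volume_setOf_apply_mem_of_subsingleton]

lemma volume_ball_eq_ofReal {ρ : ℝ} (hρ : 0 ≤ ρ) (x : Plane) :
    volume (ball x ρ) = ENNReal.ofReal (Real.pi * ρ ^ 2) := by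
  rw [EuclideanSpace.volume_ball_fin_two, mul_comm, ENNReal.ofReal_mul Real.pi_pos.le,
    ENNReal.ofReal_pow hρ]

lemma volume_nonempty_inter_pair [Fintype ι] [DecidableEq ι] {r : ι → ℝ} (hr : ∀ i, 0 < r i)
    {i j : ι} (hij : i ≠ j) (huniv : Finset.univ = {i, j}) {Q : Set Plane}
    (hQ : MeasurableSet Q) :
    volume ({T | (diskInter r T).Nonempty} ∩ {T | T i ∈ Q}) =
      volume Q * ENNReal.ofReal (Real.pi * (r i + r j) ^ 2) := by
  have hmem (k : ι) : k = i ∨ k = j := by simpa [huniv] using Finset.mem_univ k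
  let i' : ({i} : Finset ι) := ⟨i, Finset.mem_singleton_self i⟩
  have hcompl : ({i}ᶜ : Finset ι) = {j} := by
    ext k
    rcases hmem k with rfl | rfl <;> simp [hij, hij.symm]
  have hset : {T | (diskInter r T).Nonempty} ∩ {T | T i ∈ Q} = {T : ι → Plane |
      (fun k : ({i} : Finset ι) => T k) ∈ {U : ({i} : Finset ι) → Plane | U i' ∈ Q} ∧
        ∀ k ∉ ({i} : Finset ι), T k - (fun k : ({i} : Finset ι) => T k) i' ∈
          closedBall 0 (r i + r k)} := by
    ext T
    have hinter : diskInter r T = closedBall (T i) (r i) ∩ closedBall (T j) (r j) := by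
      ext p
      rw [mem_diskInter]
      exact ⟨fun h => ⟨h i, h j⟩, fun h k => by rcases hmem k with rfl | rfl; exacts [h.1, h.2]⟩
    have hiff : (diskInter r T).Nonempty ↔ ‖T j - T i‖ ≤ r i + r j := by
      rw [hinter, ← Set.not_disjoint_iff_nonempty_inter,
        disjoint_closedBall_closedBall_iff (hr i).le (hr j).le, not_lt, dist_comm, dist_eq_norm]
    simp only [Set.mem_inter_iff, Set.mem_ofPred_eq, hiff, mem_closedBall_zero_iff, i']
    refine ⟨fun h => ⟨h.2, fun k hk => ?_⟩, fun h => ⟨h.2 j (by simpa using hij.symm), h.1⟩⟩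
    rcases hmem k with rfl | rfl
    · simp at hk
    · exact h.1
  have hA : MeasurableSet {U : ({i} : Finset ι) → Plane | U i' ∈ Q} := measurable_pi_apply i' hQ
  rw [hset, volume_setOf_restrict_mem (c := fun U => U i') {i} hA (by fun_prop)
    fun k => isClosed_closedBall.measurableSet, hcompl, Finset.prod_singleton,
    Measure.addHaar_closedBall_eq_addHaar_ball, volume_ball_eq_ofReal (add_pos (hr i) (hr j)).le,
    volume_setOf_apply_mem_of_subsingleton]

lemma volume_tight_univ_inter_pair [Fintype ι] [DecidableEq ι] {r : ι → ℝ} (hr : ∀ i, 0 < r i)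
    {i j : ι} (hij : i ≠ j) (huniv : Finset.univ = {i, j}) {Q : Set Plane}
    (hQ : MeasurableSet Q) (h0 : volume Q ≠ 0) (htop : volume Q ≠ ⊤) :
    volume (tight r Finset.univ ∩ {T | T i ∈ Q}) =
      volume Q * ENNReal.ofReal (2 * Real.pi * (r i * r j)) := by
  have : Nonempty ι := ⟨i⟩
  have hi := hr i
  have hj := hr j
  have hmem (k : ι) : k = i ∨ k = j := by simpa [huniv] using Finset.mem_univ k
  have hcompl : ({i}ᶜ : Finset ι) = {j} := by
    ext k
    rcases hmem k with rfl | rfl <;> simp [hij, hij.symm]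
  have hcompl' : ({j}ᶜ : Finset ι) = {i} := by
    ext k
    rcases hmem k with rfl | rfl <;> simp [hij, hij.symm]
  have hsum := volume_nonempty_inter hr i hQ
  rw [volume_nonempty_inter_pair hr hij huniv hQ, ← Finset.powerset_univ, huniv,
    Finset.sum_powerset_insert (by simpa using hij), ← LawfulSingleton.insert_empty_eq j,
    Finset.sum_powerset_insert (by simp), Finset.sum_powerset_insert (by simp),
    Finset.powerset_empty] at hsum
  simp only [Finset.sum_singleton, LawfulSingleton.insert_empty_eq, tight_empty, Set.empty_inter,
    measure_empty, zero_add, volume_tight_singleton_inter hr hQ h0 htop, hcompl, hcompl',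
    Finset.prod_singleton, volume_ball_eq_ofReal hi.le, volume_ball_eq_ofReal hj.le] at hsum
  rw [huniv]
  rw [show Real.pi * (r i + r j) ^ 2 =
      Real.pi * r i ^ 2 + (Real.pi * r j ^ 2 + 2 * Real.pi * (r i * r j)) by ring,
    ENNReal.ofReal_add (by positivity) (by positivity),
    ENNReal.ofReal_add (by positivity) (by positivity), mul_add, mul_add] at hsum
  rwa [ENNReal.add_right_inj (ENNReal.mul_ne_top htop ENNReal.ofReal_ne_top),
    ENNReal.add_right_inj (ENNReal.mul_ne_top htop ENNReal.ofReal_ne_top), eq_comm] at hsum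

lemma volume_tight_inter_eq [Fintype ι] [DecidableEq ι] {r : ι → ℝ} (hr : ∀ i, 0 < r i)
    (G : Finset ι) {Q : Set Plane} (hQ : MeasurableSet Q) (h0 : volume Q ≠ 0)
    (htop : volume Q ≠ ⊤) (i : ι) :
    volume (tight r G ∩ {T | T i ∈ Q}) = volume Q * ENNReal.ofReal
      ((if G.card = 1 then ∏ k ∈ Gᶜ, (Real.pi * r k ^ 2) else 0) +
        if G.card = 2 then 2 * Real.pi * (∏ k ∈ G, r k) * ∏ k ∈ Gᶜ, (Real.pi * r k ^ 2) else 0) := by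
  have : Nonempty ι := ⟨i⟩
  have hprod : ∏ k ∈ Gᶜ, volume (ball (0 : Plane) (r k)) =
      ENNReal.ofReal (∏ k ∈ Gᶜ, (Real.pi * r k ^ 2)) := by
    rw [ENNReal.ofReal_prod_of_nonneg fun k _ => by positivity]
    exact Finset.prod_congr rfl fun k _ => volume_ball_eq_ofReal (hr k).le 0
  rcases G.eq_empty_or_nonempty with rfl | ⟨g, hg⟩
  · simp [tight_empty]
  rcases lt_trichotomy G.card 2 with h | h | h
  · obtain ⟨a, rfl⟩ := Finset.card_eq_one.1 (le_antisymm (by omega) (Finset.card_pos.2 ⟨g, hg⟩))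
    rw [volume_tight_singleton_inter hr hQ h0 htop, hprod]
    simp
  · obtain ⟨a, b, hab, rfl⟩ := Finset.card_eq_two.1 h
    have ha : a ∈ ({a, b} : Finset ι) := by simp
    have hb : b ∈ ({a, b} : Finset ι) := by simp
    have huniv : (Finset.univ : Finset ({a, b} : Finset ι)) = {⟨a, ha⟩, ⟨b, hb⟩} := by
      ext ⟨k, hk⟩
      simp [eq_comm]
    rw [volume_inter_eval_preimage_eq (measurableSet_tight hr _) (add_right_mem_tight_iff hr _)
      hQ h0 htop i a, volume_tight_inter hr ha hQ, hprod,
      volume_tight_univ_inter_pair (r := fun k : ({a, b} : Finset ι) => r k) (fun k => hr k)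
        (by simpa using hab) huniv hQ h0 htop,
      mul_assoc, ← ENNReal.ofReal_mul (by have := hr a; have := hr b; positivity)]
    simp [h, Finset.prod_pair hab]
  · rw [volume_inter_eval_preimage_eq (measurableSet_tight hr _) (add_right_mem_tight_iff hr _)
      hQ h0 htop i g, volume_tight_inter hr hg hQ,
      measure_mono_null Set.inter_subset_left
        (volume_tight_univ_eq_zero (r := fun k : G => r k) (fun k => hr k) (by simpa using h))]
    simp [show G.card ≠ 1 by omega, h.ne']

lemma sum_powersetCard_two [Fintype ι] [LinearOrder ι] {M : Type*} [AddCommMonoid M]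
    (f : Finset ι → M) :
    ∑ G ∈ Finset.powersetCard 2 Finset.univ, f G =
      ∑ i : ι, ∑ j ∈ Finset.univ.filter (fun j => i < j), f {i, j} := by
  rw [Finset.sum_sigma']
  symm
  refine Finset.sum_bij (fun x _ => {x.1, x.2}) ?_ ?_ ?_ fun _ _ => rfl
  · rintro ⟨i, j⟩ h
    simp only [Finset.mem_sigma, Finset.mem_filter, Finset.mem_univ, true_and] at h
    simp [Finset.mem_powersetCard, Finset.card_pair h.ne]
  · rintro ⟨i, j⟩ h ⟨k, l⟩ h' heq
    simp only [Finset.mem_sigma, Finset.mem_filter, Finset.mem_univ, true_and] at h h'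
    have hi : i = k ∨ i = l := by simpa using Finset.ext_iff.1 heq i
    have hj : j = k ∨ j = l := by simpa using Finset.ext_iff.1 heq j
    rcases hi with rfl | rfl <;> rcases hj with rfl | rfl
    · exact absurd h (lt_irrefl _)
    · rfl
    · exact absurd h h'.not_gt
    · exact absurd h (lt_irrefl _)
  · intro G hG
    obtain ⟨a, b, hab, rfl⟩ := Finset.card_eq_two.1 (Finset.mem_powersetCard.1 hG).2
    rcases hab.lt_or_gt with h | h
    · exact ⟨⟨a, b⟩, by simpa using h, rfl⟩
    · exact ⟨⟨b, a⟩, by simpa using h, Finset.pair_comm b a⟩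

lemma volume_nonempty_inter_eq [Fintype ι] [LinearOrder ι] {r : ι → ℝ} (hr : ∀ i, 0 < r i)
    {Q : Set Plane} (hQ : MeasurableSet Q) (h0 : volume Q ≠ 0) (htop : volume Q ≠ ⊤) (i₀ : ι) :
    volume ({T | (diskInter r T).Nonempty} ∩ {T | T i₀ ∈ Q}) = volume Q * ENNReal.ofReal
      (∑ i : ι, ∏ k ∈ {i}ᶜ, (Real.pi * r k ^ 2) +
        ∑ i : ι, ∑ j ∈ Finset.univ.filter (fun j => i < j),
          2 * Real.pi * (r i * r j) * ∏ k ∈ {i, j}ᶜ, (Real.pi * r k ^ 2)) := by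
  have : Nonempty ι := ⟨i₀⟩
  rw [volume_nonempty_inter hr i₀ hQ]
  simp_rw [volume_tight_inter_eq hr _ hQ h0 htop i₀]
  rw [← Finset.mul_sum, ← ENNReal.ofReal_sum_of_nonneg, Finset.sum_add_distrib,
    ← Finset.sum_filter, ← Finset.sum_filter, Finset.univ_filter_card_eq,
    Finset.univ_filter_card_eq, sum_powersetCard_two, Finset.powersetCard_one, Finset.sum_map]
  · refine congrArg _ (congrArg _ (congrArg₂ _ rfl
      (Finset.sum_congr rfl fun i _ => Finset.sum_congr rfl fun j hj => ?_)))
    rw [Finset.prod_pair (Finset.mem_filter.1 hj).2.ne]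
  · intro G _
    have := fun k => (hr k).le
    have h1 : 0 ≤ ∏ k ∈ G, r k := Finset.prod_nonneg fun k _ => this k
    have h2 : 0 ≤ ∏ k ∈ Gᶜ, (Real.pi * r k ^ 2) := Finset.prod_nonneg fun k _ => by positivity
    positivity

/-- Fixing the first disk instead of letting its center range over `Q` divides the volume by that
of `Q`. -/
lemma volume_nonempty_inter_fin_succ {m : ℕ} (r : Fin (m + 1) → ℝ) {Q : Set Plane}
    (hQ : MeasurableSet Q) (t : Plane) :
    volume ({T | (diskInter r T).Nonempty} ∩ {T | T 0 ∈ Q}) =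
      volume Q * volume {T : Fin m → Plane |
        (closedBall t (r 0) ∩ ⋂ i : Fin m, closedBall (T i) (r i.succ)).Nonempty} := by
  let e := MeasurableEquiv.piFinSuccAbove (fun _ : Fin (m + 1) => Plane) 0
  let S (x : Plane) : Set (Fin m → Plane) := {T |
    (closedBall x (r 0) ∩ ⋂ i : Fin m, closedBall (T i) (r i.succ)).Nonempty}
  let D : Set (Plane × (Fin m → Plane)) := {x | x.2 ∈ S x.1 ∧ x.1 ∈ Q}
  have hpre : {T | (diskInter r T).Nonempty} ∩ {T | T 0 ∈ Q} = e ⁻¹' D := by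
    ext T
    have : diskInter r T =
        closedBall (T 0) (r 0) ∩ ⋂ i : Fin m, closedBall (T i.succ) (r i.succ) := by
      ext p
      simp [diskInter, Fin.forall_fin_succ]
    simp only [Set.mem_inter_iff, Set.mem_ofPred_eq, this]
    rfl
  have hD : MeasurableSet D := by
    rw [← e.measurableSet_preimage, ← hpre]
    exact (measurableSet_nonempty_diskInter r).inter (measurable_pi_apply 0 hQ)
  have htr (x : Plane) : volume (S x) = volume (S t) := by
    rw [← measure_preimage_add_right volume (fun _ : Fin m => x - t) (S x)]
    congr 1
    ext T
    constructor
    · rintro ⟨p, hp, hp'⟩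
      refine ⟨p + (t - x), ?_, ?_⟩
      · simp only [mem_closedBall, dist_eq_norm] at hp ⊢
        rwa [show p + (t - x) - t = p - x by abel]
      · simp only [Set.mem_iInter, mem_closedBall, dist_eq_norm, Pi.add_apply] at hp' ⊢
        intro i
        rw [show p + (t - x) - T i = p - (T i + (x - t)) by abel]
        exact hp' i
    · rintro ⟨p, hp, hp'⟩
      refine ⟨p + (x - t), ?_, ?_⟩
      · simp only [mem_closedBall, dist_eq_norm] at hp ⊢
        rwa [show p + (x - t) - x = p - t by abel]
      · simpa [dist_add_right] using hp'
  rw [hpre, (volume_preserving_piFinSuccAbove _ _).measure_preimage_equiv,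
    Measure.volume_eq_prod, Measure.prod_apply hD, mul_comm, ← lintegral_indicator_const hQ]
  refine lintegral_congr fun x => ?_
  by_cases hx : x ∈ Q
  · rw [Set.indicator_of_mem hx, ← show volume (S t) = _ from rfl, ← htr x]
    congr 1
    ext T
    exact and_iff_left hx
  · rw [Set.indicator_of_notMem hx]
    exact (congrArg _ (Set.eq_empty_of_forall_notMem fun T hT => hx hT.2)).trans measure_empty

end DiskIntersection

theorem volume_inter_nonempty_disks (n : ℕ) (hn : 2 ≤ n)
    (t₁ : EuclideanSpace ℝ (Fin 2)) (r : Fin n → ℝ) (hr : ∀ i, 0 < r i) :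
    volume {T : Fin (n - 1) → EuclideanSpace ℝ (Fin 2) |
        closedBall t₁ (r ⟨0, by omega⟩) ∩
          (⋂ i : Fin (n - 1), closedBall (T i) (r ⟨i.val + 1, by omega⟩)) ≠ ∅}
      = ENNReal.ofReal
          (Real.pi ^ (n - 1) * (∑ i : Fin n, ∏ j ∈ Finset.univ \ {i}, r j ^ 2) +
            2 * Real.pi ^ (n - 1) *
              ∑ i : Fin n, ∑ j ∈ Finset.univ.filter (fun j => i < j),
                r i * r j * ∏ k ∈ Finset.univ \ {i, j}, r k ^ 2) := by
  obtain ⟨m, rfl⟩ : ∃ m, n = m + 1 := ⟨n - 1, by omega⟩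
  have hQ0 : volume (closedBall (0 : EuclideanSpace ℝ (Fin 2)) 1) ≠ 0 :=
    (measure_closedBall_pos _ _ one_pos).ne'
  have hQtop : volume (closedBall (0 : EuclideanSpace ℝ (Fin 2)) 1) ≠ ⊤ :=
    measure_closedBall_lt_top.ne
  have hQ : MeasurableSet (closedBall (0 : EuclideanSpace ℝ (Fin 2)) 1) :=
    isClosed_closedBall.measurableSet
  have key := DiskIntersection.volume_nonempty_inter_eq hr hQ hQ0 hQtop 0
  rw [DiskIntersection.volume_nonempty_inter_fin_succ r hQ t₁,
    ENNReal.mul_right_inj hQ0 hQtop] at key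
  simp only [← Set.nonempty_iff_ne_empty]
  refine key.trans (congrArg ENNReal.ofReal ?_)
  simp only [Finset.mul_sum, Finset.prod_mul_distrib, Finset.prod_const,
    ← Finset.compl_eq_univ_sdiff]
  refine congrArg₂ _ (Finset.sum_congr rfl fun i _ => ?_)
    (Finset.sum_congr rfl fun i _ => Finset.sum_congr rfl fun j hj => ?_)
  · simp [Finset.card_compl]
  · rw [Finset.card_compl, Finset.card_pair (Finset.mem_filter.1 hj).2.ne, Fintype.card_fin]
    obtain ⟨k, rfl⟩ : ∃ k, m = k + 1 := ⟨m - 1, by omega⟩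
    rw [show k + 1 + 1 - 2 = k from rfl, show k + 1 + 1 - 1 = k + 1 from rfl]
    ring
end

section
/- Fix a real number α with 0 < α < 1 and nonnegative integers d and m. Then lim_{u → ∞} [∫_{u}^{u+1} v^{d} ((v−u)/(v−u^{α}))^{m/2} e^{−v²/2} dv] / (u^{d−m−1} e^{−u²/2}) = Γ(1 + m/2). -/
open Filter

/-- The rescaled integrand obtained from the substitution `v = u + t / u`. -/
noncomputable def rescaledIntegrand (α : ℝ) (d m : ℕ) (u t : ℝ) : ℝ :=
  (1 + t / u ^ 2) ^ d * (t / (1 - u ^ (α - 1) + t / u ^ 2)) ^ ((m : ℝ) / 2) *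
    Real.exp (-t - (t / u) ^ 2 / 2)

theorem integrand_add_div_eq (α : ℝ) (d m : ℕ) {u t : ℝ} (hu : 0 < u)
    (hα : u ^ (α - 1) ≤ 1 / 2) (ht : 0 ≤ t) :
    (u + t / u) ^ d * ((u + t / u - u) / (u + t / u - u ^ α)) ^ ((m : ℝ) / 2) *
        Real.exp (-(u + t / u) ^ 2 / 2) =
      u * (u ^ ((d : ℝ) - m - 1) * Real.exp (-u ^ 2 / 2)) * rescaledIntegrand α d m u t := by
  have hD : 0 < 1 - u ^ (α - 1) + t / u ^ 2 := by
    have : 0 ≤ t / u ^ 2 := by positivity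
    linarith
  have hpow : u ^ α = u * u ^ (α - 1) := by
    rw [Real.rpow_sub_one hu.ne']
    field_simp
  have hratio : (u + t / u - u) / (u + t / u - u ^ α) =
      (t / (1 - u ^ (α - 1) + t / u ^ 2)) / u ^ 2 := by
    have hden : u + t / u - u ^ α = u * (1 - u ^ (α - 1) + t / u ^ 2) := by
      rw [hpow]
      field_simp
      ring
    rw [hden, add_sub_cancel_left]
    generalize 1 - u ^ (α - 1) + t / u ^ 2 = D at hD
    field_simp
  have hsq : (u ^ 2) ^ ((m : ℝ) / 2) = u ^ m := by
    rw [← Real.rpow_natCast u 2, ← Real.rpow_mul hu.le, ← Real.rpow_natCast u m]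
    congr 1
    push_cast
    ring
  have hbase : u + t / u = u * (1 + t / u ^ 2) := by field_simp
  have hexp : Real.exp (-(u + t / u) ^ 2 / 2) =
      Real.exp (-u ^ 2 / 2) * Real.exp (-t - (t / u) ^ 2 / 2) := by
    rw [← Real.exp_add]
    congr 1
    field_simp
    ring
  have hscale : u ^ ((d : ℝ) - m - 1) = u ^ d / u ^ m / u := by
    rw [Real.rpow_sub_one hu.ne', Real.rpow_sub hu, Real.rpow_natCast, Real.rpow_natCast]
  rw [hratio, Real.div_rpow (div_nonneg ht hD.le) (by positivity), hsq, hexp, hscale, hbase,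
    mul_pow, rescaledIntegrand]
  field_simp

theorem setIntegral_div_eq_setIntegral_rescaledIntegrand (α : ℝ) (d m : ℕ) {u : ℝ} (hu : 0 < u)
    (hα : u ^ (α - 1) ≤ 1 / 2) :
    (∫ v in Set.Icc u (u + 1),
        v ^ d * ((v - u) / (v - u ^ α)) ^ ((m : ℝ) / 2) * Real.exp (-v ^ 2 / 2)) /
        (u ^ ((d : ℝ) - m - 1) * Real.exp (-u ^ 2 / 2)) =
      ∫ t in Set.Ioi 0, (Set.Ioc 0 u).indicator (rescaledIntegrand α d m u) t := by
  have hsub := intervalIntegral.integral_comp_add_div (a := 0) (b := u)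
    (fun v => v ^ d * ((v - u) / (v - u ^ α)) ^ ((m : ℝ) / 2) * Real.exp (-v ^ 2 / 2)) hu.ne' u
  rw [zero_div, add_zero, div_self hu.ne', intervalIntegral.integral_of_le hu.le,
    intervalIntegral.integral_of_le (by linarith : u ≤ u + 1),
    MeasureTheory.setIntegral_congr_fun measurableSet_Ioc
      (fun t ht => integrand_add_div_eq α d m hu hα ht.1.le),
    MeasureTheory.integral_const_mul, smul_eq_mul, mul_assoc] at hsub
  have hpos : 0 < u ^ ((d : ℝ) - m - 1) * Real.exp (-u ^ 2 / 2) := by positivity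
  rw [MeasureTheory.integral_Icc_eq_integral_Ioc, ← mul_left_cancel₀ hu.ne' hsub,
    mul_div_cancel_left₀ _ hpos.ne', MeasureTheory.setIntegral_indicator measurableSet_Ioc,
    Set.inter_eq_right.mpr Set.Ioc_subset_Ioi_self]

theorem measurable_rescaledIntegrand (α : ℝ) (d m : ℕ) (u : ℝ) :
    Measurable (rescaledIntegrand α d m u) := by
  unfold rescaledIntegrand
  fun_prop

theorem norm_rescaledIntegrand_le (α : ℝ) (d m : ℕ) {u t : ℝ} (hu : 1 ≤ u)
    (hα : u ^ (α - 1) ≤ 1 / 2) (ht : 0 ≤ t) (htu : t ≤ u) :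
    ‖rescaledIntegrand α d m u t‖ ≤
      2 ^ d * 2 ^ ((m : ℝ) / 2) * (Real.exp (-t) * t ^ (1 + (m : ℝ) / 2 - 1)) := by
  have hq : 0 ≤ t / u ^ 2 := by positivity
  have hq1 : t / u ^ 2 ≤ 1 := (div_le_one (by positivity)).mpr (by nlinarith)
  have hD : 1 / 2 ≤ 1 - u ^ (α - 1) + t / u ^ 2 := by linarith
  have hfrac : t / (1 - u ^ (α - 1) + t / u ^ 2) ≤ 2 * t := by
    rw [div_le_iff₀ (by linarith)]
    nlinarith
  have hfrac0 : 0 ≤ t / (1 - u ^ (α - 1) + t / u ^ 2) := div_nonneg ht (by linarith)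
  have hexp : Real.exp (-t - (t / u) ^ 2 / 2) ≤ Real.exp (-t) :=
    Real.exp_le_exp.mpr (by nlinarith [sq_nonneg (t / u)])
  rw [rescaledIntegrand, Real.norm_of_nonneg (by positivity)]
  calc _ ≤ 2 ^ d * (2 * t) ^ ((m : ℝ) / 2) * Real.exp (-t) := by
        gcongr
        linarith
    _ = _ := by
        rw [Real.mul_rpow zero_le_two ht, add_sub_cancel_left]
        ring

theorem tendsto_rescaledIntegrand {α : ℝ} (hα₁ : α < 1) (d m : ℕ) (t : ℝ) :
    Tendsto (fun u => rescaledIntegrand α d m u t) atTop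
      (nhds (Real.exp (-t) * t ^ (1 + (m : ℝ) / 2 - 1))) := by
  have hpow : Tendsto (fun u : ℝ => u ^ (α - 1)) atTop (nhds 0) := by
    simpa using tendsto_rpow_neg_atTop (sub_pos.mpr hα₁)
  have hquot : Tendsto (fun u : ℝ => t / u ^ 2) atTop (nhds 0) :=
    tendsto_const_nhds.div_atTop (tendsto_pow_atTop two_ne_zero)
  have hlin : Tendsto (fun u : ℝ => t / u) atTop (nhds 0) :=
    tendsto_const_nhds.div_atTop tendsto_id
  have hfrac : Tendsto (fun u : ℝ => t / (1 - u ^ (α - 1) + t / u ^ 2)) atTop (nhds t) := by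
    simpa [Pi.div_def] using (tendsto_const_nhds (x := t)).div ((hpow.const_sub 1).add hquot) (by norm_num)
  have hrpow := hfrac.rpow_const (p := (m : ℝ) / 2) (Or.inr (by positivity))
  have hexp : Tendsto (fun u : ℝ => Real.exp (-t - (t / u) ^ 2 / 2)) atTop
      (nhds (Real.exp (-t))) := by
    refine (Real.continuous_exp.tendsto _).comp ?_
    simpa using ((hlin.pow 2).div_const 2).const_sub (-t)
  have hprod := (((hquot.const_add 1).pow d).mul hrpow).mul hexp
  simpa [rescaledIntegrand, mul_comm] using hprod

theorem laplace_type_integral_limit (α : ℝ) (hα₀ : 0 < α) (hα₁ : α < 1) (d m : ℕ) :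
    Tendsto
      (fun u : ℝ =>
        (∫ v in Set.Icc u (u + 1),
            v ^ d * ((v - u) / (v - u ^ α)) ^ ((m : ℝ) / 2) * Real.exp (-v ^ 2 / 2)) /
          (u ^ ((d : ℝ) - m - 1) * Real.exp (-u ^ 2 / 2)))
      atTop (nhds (Real.Gamma (1 + (m : ℝ) / 2))) := by
  have hs : 0 < 1 + (m : ℝ) / 2 := by positivity
  have hpow : ∀ᶠ u : ℝ in atTop, u ^ (α - 1) ≤ 1 / 2 := by
    have h : Tendsto (fun u : ℝ => u ^ (α - 1)) atTop (nhds 0) := by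
      simpa using tendsto_rpow_neg_atTop (sub_pos.mpr hα₁)
    exact h.eventually_le_const (by norm_num)
  rw [Real.Gamma_eq_integral hs]
  refine Tendsto.congr' (f₁ := fun u =>
    ∫ t in Set.Ioi 0, (Set.Ioc 0 u).indicator (rescaledIntegrand α d m u) t) ?_ ?_
  · filter_upwards [hpow, eventually_gt_atTop 0] with u hu hu0
    exact (setIntegral_div_eq_setIntegral_rescaledIntegrand α d m hu0 hu).symm
  refine MeasureTheory.tendsto_integral_filter_of_dominated_convergence
    (fun t => 2 ^ d * 2 ^ ((m : ℝ) / 2) * (Real.exp (-t) * t ^ (1 + (m : ℝ) / 2 - 1))) ?_ ?_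
    ((Real.GammaIntegral_convergent hs).const_mul _) ?_
  · exact Eventually.of_forall fun u =>
      ((measurable_rescaledIntegrand α d m u).indicator measurableSet_Ioc).aestronglyMeasurable
  · filter_upwards [hpow, eventually_ge_atTop 1] with u hu hu1
    filter_upwards [MeasureTheory.ae_restrict_mem measurableSet_Ioi] with t ht
    have ht0 : 0 < t := ht
    by_cases htu : t ∈ Set.Ioc 0 u
    · rw [Set.indicator_of_mem htu]
      exact norm_rescaledIntegrand_le α d m hu1 hu ht0.le htu.2
    · rw [Set.indicator_of_notMem htu, norm_zero]
      positivity
  · filter_upwards [MeasureTheory.ae_restrict_mem measurableSet_Ioi] with t ht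
    refine (tendsto_rescaledIntegrand hα₁ d m t).congr' ?_
    filter_upwards [eventually_ge_atTop t] with u hu
    exact (Set.indicator_of_mem (show t ∈ Set.Ioc 0 u from ⟨ht, hu⟩) _).symm
end
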